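/- arXiv:2403.14122 — 2 statements merged into one kernel-verified Lean document; each statement's English description precedes it below -/
import Mathlib

section
/- Let p ≥ 3 and (β,h) be a p-critical point, let m be any global maximizer of H = H_{β,h,p} (so H''(m) < 0), and let A be an open neighborhood of m whose closure contains no other global maximizer of H. Then there exists a constant C > 0 such that for all N large enough, sup_{x ∈ ℝ} | P( (S_N − N m)/√(−N/H''(m)) ≤ x | S_N/N ∈ A ) − Φ(x) | ≤ C·N^{−1/2}. -/
open Real MeasureTheory Filter
open scoped BigOperators Topology

noncomputable section

/-- The spin value (`±1`) of a Boolean coordinate. -/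
def spin (b : Bool) : ℝ := if b then 1 else -1

/-- The total magnetization `S_N = ∑ᵢ Xᵢ` of a configuration. -/
def mag {N : ℕ} (x : Fin N → Bool) : ℝ := ∑ i, spin (x i)

/-- The Hamiltonian of the `p`-spin Curie-Weiss model:
`β N^{1-p} ∑_{i₁,…,i_p} x_{i₁} ⋯ x_{i_p} + h ∑ᵢ xᵢ`. -/
def cwHamiltonian (p N : ℕ) (β h : ℝ) (x : Fin N → Bool) : ℝ :=
  β * (N : ℝ) ^ ((1 : ℤ) - (p : ℤ)) * (∑ i : Fin p → Fin N, ∏ j, spin (x (i j)))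
    + h * mag x

/-- The (unnormalized) Gibbs weight of a configuration. -/
def cwWeight (p N : ℕ) (β h : ℝ) (x : Fin N → Bool) : ℝ :=
  Real.exp (cwHamiltonian p N β h x)

/-- The probability of an event `E` under the `p`-spin Curie-Weiss measure `P_{β,h,p}`. -/
def cwProb (p N : ℕ) (β h : ℝ) (E : Set (Fin N → Bool)) : ℝ :=
  (∑ x : Fin N → Bool, E.indicator (cwWeight p N β h) x) /
    ∑ x : Fin N → Bool, cwWeight p N β h x

/-- Conditional probability of `E` given `A` under the `p`-spin Curie-Weiss measure. -/
def cwCondProb (p N : ℕ) (β h : ℝ) (E A : Set (Fin N → Bool)) : ℝ :=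
  cwProb p N β h (E ∩ A) / cwProb p N β h A

/-- The binary entropy function `I(x) = ½[(1+x)log(1+x) + (1-x)log(1-x)]`. -/
def binEnt (x : ℝ) : ℝ := (1/2) * ((1+x) * Real.log (1+x) + (1-x) * Real.log (1-x))

/-- The function `H_{β,h,p}(x) = βxᵖ + hx - I(x)`. -/
def Hfun (p : ℕ) (β h : ℝ) (x : ℝ) : ℝ := β * x ^ p + h * x - binEnt x

/-- `m` is a global maximizer of `H_{β,h,p}` on `[-1,1]`, lying in `(-1,1)`. -/
def isMaximizer (p : ℕ) (β h m : ℝ) : Prop :=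
  m ∈ Set.Ioo (-1 : ℝ) 1 ∧ ∀ x ∈ Set.Icc (-1 : ℝ) 1, Hfun p β h x ≤ Hfun p β h m

/-- `m` is the unique global maximizer of `H_{β,h,p}`. -/
def isUniqueMaximizer (p : ℕ) (β h m : ℝ) : Prop :=
  isMaximizer p β h m ∧ ∀ m', isMaximizer p β h m' → m' = m

/-- `(β,h)` is a `p`-regular point with unique global maximizer `m`. -/
def pRegular (p : ℕ) (β h m : ℝ) : Prop :=
  isUniqueMaximizer p β h m ∧ iteratedDeriv 2 (Hfun p β h) m < 0

/-- `(β,h)` is a `p`-special point with unique global maximizer `m`. -/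
def pSpecial (p : ℕ) (β h m : ℝ) : Prop :=
  isUniqueMaximizer p β h m ∧ iteratedDeriv 2 (Hfun p β h) m = 0

/-- `(β,h)` is a `p`-critical point: `H_{β,h,p}` has more than one global maximizer. -/
def pCritical (p : ℕ) (β h : ℝ) : Prop :=
  ∃ m₁ m₂, m₁ ≠ m₂ ∧ isMaximizer p β h m₁ ∧ isMaximizer p β h m₂

/-- The probability assigned to a set `S ⊆ ℝ` by the centered Gaussian with variance `v`. -/
def gaussProb (v : ℝ) (S : Set ℝ) : ℝ :=
  ∫ t in S, (Real.sqrt (2 * Real.pi * v))⁻¹ * Real.exp (-t ^ 2 / (2 * v))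

/-- The CDF of the centered Gaussian with variance `v`. -/
def gaussCDF (v x : ℝ) : ℝ := gaussProb v (Set.Iic x)

/-- The standard normal CDF `Φ`. -/
def stdNormCDF (x : ℝ) : ℝ := gaussCDF 1 x

/-- The CDF of the limit law `F` at a `p`-special point, where `c = H⁽⁴⁾(m_*)`:
`dF(x) = (2/Γ(1/4)) (-c/24)^{1/4} exp(c x⁴/24) dx`. -/
def specialCDF (c x : ℝ) : ℝ :=
  ∫ t in Set.Iic x, (2 / Real.Gamma (1/4)) * ((-c) / 24) ^ ((1:ℝ)/4) * Real.exp (c * t ^ 4 / 24)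

/-- The inverse hyperbolic tangent `tanh⁻¹(t) = ½ log((1+t)/(1-t))`. -/
def arctanh (t : ℝ) : ℝ := (1/2) * Real.log ((1+t)/(1-t))

/-- The function `g(t) = tanh⁻¹(t)/(p t^{p-1})`, so that the maximum pseudolikelihood
estimate of `β` is `g(X̄)`. -/
def gMPL (p : ℕ) (t : ℝ) : ℝ := arctanh t / (p * t ^ (p - 1))

/-- The threshold `β*(p) = inf{β ≥ 0 : sup_{x∈[0,1]} H_{β,0,p}(x) > 0}`. -/
def betaStar (p : ℕ) : ℝ := sInf {b : ℝ | 0 ≤ b ∧ ∃ x ∈ Set.Icc (0:ℝ) 1, 0 < Hfun p b 0 x}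

/-! ### Reduction to sums over the number of positive spins -/

lemma mag_eq_two_mul_card_sub {N : ℕ} (σ : Fin N → Bool) :
    mag σ = 2 * ((Finset.univ.filter fun i => σ i = true).card : ℝ) - N := by
  have h : ∀ b : Bool, spin b = 2 * (if b = true then 1 else 0) - 1 := by
    intro b; cases b <;> norm_num [spin]
  simp only [mag, h, Finset.sum_sub_distrib, ← Finset.mul_sum, Finset.sum_boole]
  simp

lemma sum_bool_config_eq_sum_choose (N : ℕ) (F : ℕ → ℝ) :
    ∑ σ : Fin N → Bool, F (Finset.univ.filter fun i => σ i = true).card =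
      ∑ k ∈ Finset.range (N + 1), (N.choose k : ℝ) * F k := by
  have h := Finset.sum_powerset_apply_card F (x := (Finset.univ : Finset (Fin N)))
  simp only [Finset.card_univ, Fintype.card_fin, nsmul_eq_mul] at h
  rw [← h]
  refine Finset.sum_bij' (fun σ _ => Finset.univ.filter fun i => σ i = true)
    (fun s _ i => decide (i ∈ s)) ?_ ?_ ?_ ?_ ?_ <;> simp

/-- The exponent of the Gibbs weight per site, as a function of the mean magnetization. -/
def energy (p : ℕ) (β h x : ℝ) : ℝ := β * x ^ p + h * x

/-- The mean magnetization of a configuration with `k` positive spins out of `N`. -/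
def meanMag (N k : ℕ) : ℝ := (2 * k - N) / N

lemma cwWeight_eq_exp_energy {p N : ℕ} (hN : 0 < N) (β h : ℝ) (σ : Fin N → Bool) :
    cwWeight p N β h σ = exp (N * energy p β h
      (meanMag N (Finset.univ.filter fun i => σ i = true).card)) := by
  have hN' : (N : ℝ) ≠ 0 := by positivity
  rw [cwWeight, cwHamiltonian, ← Fintype.sum_pow (fun i => spin (σ i)) p, meanMag,
    ← mag_eq_two_mul_card_sub]
  change exp (β * (N : ℝ) ^ ((1 : ℤ) - (p : ℤ)) * mag σ ^ p + h * mag σ) = _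
  congr 1
  rw [zpow_sub₀ hN', zpow_one, zpow_natCast, energy, div_pow]
  field_simp

lemma cwCondProb_eq_sum_choose {p N : ℕ} (hN : 0 < N) (β h : ℝ) (P Q : ℝ → Prop)
    [DecidablePred P] [DecidablePred Q] :
    cwCondProb p N β h {σ | P (mag σ)} {σ | Q (mag σ)} =
      (∑ k ∈ (Finset.range (N + 1)).filter (fun k : ℕ => P (2 * k - N)),
        if Q (2 * k - N) then (N.choose k : ℝ) * exp (N * energy p β h (meanMag N k)) else 0) /
      ∑ k ∈ Finset.range (N + 1),
        if Q (2 * k - N) then (N.choose k : ℝ) * exp (N * energy p β h (meanMag N k)) else 0 := by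
  classical
  have key : ∀ (R : ℝ → Prop) [DecidablePred R],
      ∑ σ : Fin N → Bool, ({σ | R (mag σ)} : Set (Fin N → Bool)).indicator (cwWeight p N β h) σ =
      ∑ k ∈ Finset.range (N + 1), if R (2 * k - N) then
        (N.choose k : ℝ) * exp (N * energy p β h (meanMag N k)) else 0 := by
    intro R _
    have := sum_bool_config_eq_sum_choose N
      (fun k => if R (2 * k - N) then exp (N * energy p β h (meanMag N k)) else 0)
    simp only [mul_ite, mul_zero] at this
    rw [← this]
    refine Finset.sum_congr rfl fun σ _ => ?_
    simp only [Set.indicator_apply, Set.mem_ofPred_eq, mag_eq_two_mul_card_sub,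
      cwWeight_eq_exp_energy hN]
  have hZ : (∑ σ : Fin N → Bool, cwWeight p N β h σ) ≠ 0 :=
    (Finset.sum_pos (fun σ _ => exp_pos _) Finset.univ_nonempty).ne'
  rw [cwCondProb, cwProb, cwProb, div_div_div_cancel_right₀ hZ, key Q,
    show ({σ | P (mag σ)} ∩ {σ | Q (mag σ)} : Set (Fin N → Bool)) =
      {σ | P (mag σ) ∧ Q (mag σ)} from rfl, key fun s => P s ∧ Q s, Finset.sum_filter]
  simp only [ite_and]

/-! ### Binomial coefficients and entropy -/

lemma log_stirlingSeq_sub_log_sqrt_pi_mem {n : ℕ} (hn : n ≠ 0) :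
    log (Stirling.stirlingSeq n) - log √π ∈ Set.Icc (0 : ℝ) (1 / n) := by
  have hpi : 0 < √π := by positivity
  refine ⟨sub_nonneg.2 (log_le_log hpi (Stirling.sqrt_pi_le_stirlingSeq hn)), ?_⟩
  obtain ⟨n, rfl⟩ := Nat.exists_eq_succ_of_ne_zero hn
  have hmono : Monotone fun j : ℕ =>
      log (Stirling.stirlingSeq (j + 1)) - 1 / (12 * ((j + 1 : ℕ) : ℝ)) := by
    refine monotone_nat_of_le_succ fun j => ?_
    have := Stirling.log_stirlingSeq_sdiff_le (j + 1)
    have h2 : 1 / (12 * ((j + 1 : ℕ) : ℝ) * ((j + 1 : ℕ) + 1)) =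
        1 / (12 * ((j + 1 : ℕ) : ℝ)) - 1 / (12 * ((j + 1 + 1 : ℕ) : ℝ)) := by
      push_cast; field_simp; ring
    rw [h2] at this
    linarith
  have hlim : Tendsto (fun j : ℕ =>
      log (Stirling.stirlingSeq (j + 1)) - 1 / (12 * ((j + 1 : ℕ) : ℝ))) atTop (𝓝 (log √π - 0)) := by
    refine Tendsto.sub ?_ ?_
    · exact ((continuousAt_log hpi.ne').tendsto.comp Stirling.tendsto_stirlingSeq_sqrt_pi).comp
        (tendsto_add_atTop_nat 1)
    · have h1 := (tendsto_one_div_add_atTop_nhds_zero_nat (𝕜 := ℝ)).const_mul (1 / 12)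
      rw [mul_zero] at h1
      refine h1.congr fun j => ?_
      push_cast; field_simp
  have h1 := hmono.ge_of_tendsto hlim n
  have h2 : 1 / (12 * ((n + 1 : ℕ) : ℝ)) ≤ 1 / ((n + 1 : ℕ) : ℝ) := by
    apply one_div_le_one_div_of_le <;> push_cast <;> linarith [(Nat.cast_nonneg n : (0:ℝ) ≤ n)]
  simp only [Nat.succ_eq_add_one] at *
  linarith

lemma one_add_meanMag {N : ℕ} (hN : 0 < N) (k : ℕ) : 1 + meanMag N k = 2 * (k / N) := by
  have : (N : ℝ) ≠ 0 := by positivity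
  rw [meanMag]; field_simp; ring

lemma one_sub_meanMag {N k : ℕ} (hN : 0 < N) (hk : k ≤ N) :
    1 - meanMag N k = 2 * ((N - k : ℕ) / N) := by
  have : (N : ℝ) ≠ 0 := by positivity
  rw [meanMag, Nat.cast_sub hk]; field_simp; ring

lemma meanMag_mem_Icc {N k : ℕ} (hN : 0 < N) (hk : k ≤ N) :
    meanMag N k ∈ Set.Icc (-1 : ℝ) 1 := by
  have h1 := one_add_meanMag hN k
  have h2 := one_sub_meanMag hN hk
  have h3 : (0 : ℝ) ≤ 2 * (k / N) := by positivity
  have h4 : (0 : ℝ) ≤ 2 * ((N - k : ℕ) / N) := by positivity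
  constructor <;> linarith

lemma mul_binEnt_meanMag {N k : ℕ} (hN : 0 < N) (hk : k ≤ N) :
    N * binEnt (meanMag N k) = N * log 2 + k * log (k / N) +
      (N - k : ℕ) * log ((N - k : ℕ) / N) := by
  have hN' : (N : ℝ) ≠ 0 := by positivity
  rw [binEnt, one_add_meanMag hN, one_sub_meanMag hN hk]
  have key : ∀ a : ℕ, 2 * ((a : ℝ) / N) * log (2 * (a / N)) =
      2 * ((a : ℝ) / N) * log 2 + 2 * (a / N) * log (a / N) := by
    intro a
    rcases Nat.eq_zero_or_pos a with rfl | ha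
    · simp
    · have : (0 : ℝ) < a / N := by positivity
      rw [log_mul two_ne_zero this.ne']; ring
  rw [key, key, Nat.cast_sub hk]
  field_simp
  ring

/-- The entropy upper bound for binomial coefficients. -/
lemma choose_le_exp_binEnt {N k : ℕ} (hN : 0 < N) (hk : k ≤ N) :
    (N.choose k : ℝ) ≤ 2 ^ N * exp (-(N * binEnt (meanMag N k))) := by
  have hN' : (0 : ℝ) < N := by positivity
  have hpow : ∀ a : ℕ, ((a : ℝ) / N) ^ a = exp (a * log (a / N)) := by
    intro a
    rcases Nat.eq_zero_or_pos a with rfl | ha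
    · simp
    · rw [mul_comm, exp_mul, exp_log (by positivity), rpow_natCast]
  have hsum := add_pow ((k : ℝ) / N) ((N - k : ℕ) / N) N
  have h1 : (k : ℝ) / N + (N - k : ℕ) / N = 1 := by
    rw [Nat.cast_sub hk]; field_simp; ring
  rw [h1, one_pow] at hsum
  have hle : ((k : ℝ) / N) ^ k * (((N - k : ℕ) : ℝ) / N) ^ (N - k) * N.choose k ≤ 1 := by
    rw [hsum]
    exact Finset.single_le_sum (f := fun i => ((k : ℝ) / N) ^ i *
      (((N - k : ℕ) : ℝ) / N) ^ (N - i) * N.choose i) (fun i _ => by positivity)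
      (Finset.mem_range.2 (by omega))
  rw [hpow, hpow, ← exp_add] at hle
  have h2 : (2 : ℝ) ^ N = exp (N * log 2) := by
    rw [mul_comm, exp_mul, exp_log two_pos, rpow_natCast]
  rw [h2, mul_binEnt_meanMag hN hk, ← exp_add]
  have : (N : ℝ) * log 2 + -(N * log 2 + k * log (k / N) + (N - k : ℕ) * log ((N - k : ℕ) / N))
      = -(k * log (k / N) + (N - k : ℕ) * log ((N - k : ℕ) / N)) := by ring
  rw [this, exp_neg, ← one_div, le_div_iff₀ (exp_pos _), mul_comm]
  exact hle

lemma log_factorial_eq {n : ℕ} (hn : n ≠ 0) :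
    log (n.factorial : ℝ) = log (Stirling.stirlingSeq n) + 1 / 2 * log 2 + 1 / 2 * log n +
      n * log n - n := by
  have := Stirling.log_stirlingSeq_formula n
  have hn' : (n : ℝ) ≠ 0 := by positivity
  rw [log_mul two_ne_zero hn', log_div hn' (exp_pos _).ne', log_exp] at this
  linarith

/-- Stirling's approximation of `log (N.choose k)` with an explicit error term. -/
lemma abs_log_choose_sub_le {N k : ℕ} (hk0 : 0 < k) (hkN : k < N) :
    |log (N.choose k : ℝ) - (N * log 2 - N * binEnt (meanMag N k) +
      1 / 2 * log (2 / (π * N * (1 - meanMag N k ^ 2))))| ≤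
      1 / N + 1 / k + 1 / (N - k : ℕ) := by
  have hN : 0 < N := by omega
  obtain ⟨l, rfl⟩ := Nat.exists_eq_add_of_lt hkN
  have hl : k + l + 1 - k = l + 1 := by omega
  have hkle : k ≤ k + l + 1 := by omega
  rw [Nat.choose_eq_factorial_div_factorial hkle, Nat.cast_div
    (Nat.factorial_mul_factorial_dvd_factorial hkle) (by positivity),
    Nat.cast_mul, log_div (by positivity) (by positivity), log_mul (by positivity) (by positivity),
    log_factorial_eq hN.ne', log_factorial_eq hk0.ne', log_factorial_eq (by omega),
    mul_binEnt_meanMag hN hkle]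
  have hx : 1 - meanMag (k + l + 1) k ^ 2 =
      (2 * (k / (k + l + 1 : ℕ))) * (2 * ((k + l + 1 - k : ℕ) / (k + l + 1 : ℕ))) := by
    rw [← one_add_meanMag hN, ← one_sub_meanMag hN hkle]; ring
  rw [hx, hl]
  have s1 := log_stirlingSeq_sub_log_sqrt_pi_mem hN.ne'
  have s2 := log_stirlingSeq_sub_log_sqrt_pi_mem hk0.ne'
  have s3 := log_stirlingSeq_sub_log_sqrt_pi_mem (n := l + 1) (by omega)
  rw [log_sqrt pi_pos.le] at s1 s2 s3
  have hNr : (0 : ℝ) < (k + l + 1 : ℕ) := by positivity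
  have hkr : (0 : ℝ) < k := by positivity
  have hlr : (0 : ℝ) < (l + 1 : ℕ) := by positivity
  have hadd : ((k + l + 1 : ℕ) : ℝ) = k + (l + 1 : ℕ) := by push_cast; ring
  have hlog : log (2 / (π * (k + l + 1 : ℕ) * ((2 * (k / (k + l + 1 : ℕ))) *
      (2 * ((l + 1 : ℕ) / (k + l + 1 : ℕ)))))) =
      log (k + l + 1 : ℕ) - log 2 - log π - log k - log (l + 1 : ℕ) := by
    rw [← log_div, ← log_div, ← log_div, ← log_div] <;> try positivity
    congr 1
    field_simp
  rw [hlog, log_div hkr.ne' hNr.ne', log_div hlr.ne' hNr.ne']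
  generalize ((k + l + 1 : ℕ) : ℝ) = n at *
  generalize ((l + 1 : ℕ) : ℝ) = j at *
  generalize (k : ℝ) = k' at *
  subst hadd
  obtain ⟨a1, b1⟩ := s1
  obtain ⟨a2, b2⟩ := s2
  obtain ⟨a3, b3⟩ := s3
  have p1 : 0 < 1 / k' := by positivity
  have p2 : 0 < 1 / j := by positivity
  have p3 : 0 < 1 / (k' + j) := by positivity
  rw [abs_le]
  constructor <;> ring_nf at * <;> nlinarith

/-! ### Local and global behaviour of `Hfun` -/

lemma analyticAt_Hfun (p : ℕ) (β h : ℝ) {m : ℝ} (hm : m ∈ Set.Ioo (-1 : ℝ) 1) :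
    AnalyticAt ℝ (Hfun p β h) m := by
  have h1 : AnalyticAt ℝ (fun x : ℝ => log (1 + x)) m :=
    AnalyticAt.log (by fun_prop) (by linarith [hm.1])
  have h2 : AnalyticAt ℝ (fun x : ℝ => log (1 - x)) m :=
    AnalyticAt.log (by fun_prop) (by linarith [hm.2])
  unfold Hfun binEnt
  fun_prop

lemma continuous_Hfun (p : ℕ) (β h : ℝ) : Continuous (Hfun p β h) := by
  have h1 : Continuous fun x : ℝ => (1 + x) * log (1 + x) :=
    continuous_mul_log.comp (by fun_prop)
  have h2 : Continuous fun x : ℝ => (1 - x) * log (1 - x) :=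
    continuous_mul_log.comp (by fun_prop)
  unfold Hfun binEnt
  fun_prop

lemma deriv_Hfun_eq_zero {p : ℕ} {β h m : ℝ} (hmax : isMaximizer p β h m) :
    deriv (Hfun p β h) m = 0 := by
  refine IsLocalMax.deriv_eq_zero ?_
  filter_upwards [Icc_mem_nhds hmax.1.1 hmax.1.2] with x hx using hmax.2 x hx

lemma AnalyticAt.isBigO_taylor_two {f : ℝ → ℝ} {m : ℝ} (hf : AnalyticAt ℝ f m) :
    (fun x => f x - (f m + deriv f m * (x - m) + iteratedDeriv 2 f m / 2 * (x - m) ^ 2))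
      =O[𝓝 m] fun x => |x - m| ^ 3 := by
  have h1 := hf.hasFPowerSeriesAt.isBigO_sub_partialSum_pow 3
  have h2 : Tendsto (fun x : ℝ => x - m) (𝓝 m) (𝓝 0) := by
    have : ContinuousAt (fun x : ℝ => x - m) m := by fun_prop
    simpa [ContinuousAt] using this
  refine (h1.comp_tendsto h2).congr (fun x => ?_) (fun x => by simp)
  simp [FormalMultilinearSeries.partialSum, Finset.sum_range_succ, iteratedDeriv_one]
  ring

lemma exists_abs_Hfun_sub_le {p : ℕ} {β h m : ℝ} (hmax : isMaximizer p β h m) :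
    ∃ K > 0, ∀ᶠ x in 𝓝 m, |Hfun p β h x - Hfun p β h m -
      iteratedDeriv 2 (Hfun p β h) m / 2 * (x - m) ^ 2| ≤ K * |x - m| ^ 3 := by
  obtain ⟨K, hK, hb⟩ := ((analyticAt_Hfun p β h hmax.1).isBigO_taylor_two).exists_pos
  refine ⟨K, hK, hb.bound.mono fun x hx => ?_⟩
  rw [deriv_Hfun_eq_zero hmax, norm_eq_abs, norm_eq_abs, abs_of_nonneg (a := |x - m| ^ 3)
    (by positivity)] at hx
  convert hx using 2
  ring

lemma Hfun_one_lt {p : ℕ} {β h m : ℝ} (hβ : 0 < β) (hh : 0 < h) (hmax : isMaximizer p β h m) :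
    Hfun p β h 1 < Hfun p β h m := by
  set s : ℝ := exp (-2 * (β * p + h) - 1) with hs
  have hs0 : 0 < s := exp_pos _
  have hs1 : s ≤ 1 := by
    rw [hs, exp_le_one_iff]
    have : 0 ≤ β * p := by positivity
    linarith
  refine lt_of_lt_of_le ?_ (hmax.2 (1 - s) ⟨by linarith, by linarith⟩)
  have hlogs : log s = -2 * (β * p + h) - 1 := by rw [hs, log_exp]
  have hpow : 1 - p * s ≤ (1 - s) ^ p := by
    have := one_add_mul_le_pow (a := -s) (by linarith) p
    rw [← sub_eq_add_neg] at this
    linarith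
  have hlog2 : (2 - s) * log (2 - s) ≤ (2 - s) * log 2 :=
    mul_le_mul_of_nonneg_left (log_le_log (by linarith) (by linarith)) (by linarith)
  have hlog2pos : 0 < log 2 := log_pos one_lt_two
  have e1 : (1 : ℝ) + (1 - s) = 2 - s := by ring
  have e2 : (1 : ℝ) - (1 - s) = s := by ring
  have e3 : (1 : ℝ) + 1 = 2 := by norm_num
  simp only [Hfun, binEnt, e1, e2, e3, hlogs, one_pow, sub_self, zero_mul]
  have hβpow := mul_le_mul_of_nonneg_left hpow hβ.le
  nlinarith

lemma Hfun_neg_one_lt {p : ℕ} {β h m : ℝ} (hβ : 0 < β) (hh : 0 < h)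
    (hmax : isMaximizer p β h m) : Hfun p β h (-1) < Hfun p β h m := by
  refine lt_trans ?_ (Hfun_one_lt hβ hh hmax)
  have h1 : (-1 : ℝ) ^ p ≤ 1 := by
    rcases neg_one_pow_eq_or ℝ p with h | h <;> rw [h]; norm_num
  have e1 : (1 : ℝ) + 1 = 2 := by norm_num
  have e2 : (1 : ℝ) + -1 = 0 := by norm_num
  have e3 : (1 : ℝ) - -1 = 2 := by norm_num
  simp only [Hfun, binEnt, e1, e2, e3, one_pow, sub_self, zero_mul]
  have := mul_le_mul_of_nonneg_left h1 hβ.le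
  linarith

lemma Hfun_lt_of_not_isMaximizer {p : ℕ} {β h m x : ℝ} (hβ : 0 < β) (hh : 0 < h)
    (hmax : isMaximizer p β h m) (hx : x ∈ Set.Icc (-1 : ℝ) 1) (hnot : ¬ isMaximizer p β h x) :
    Hfun p β h x < Hfun p β h m := by
  rcases eq_or_lt_of_le hx.1 with rfl | h1
  · exact Hfun_neg_one_lt hβ hh hmax
  rcases eq_or_lt_of_le hx.2 with rfl | h2
  · exact Hfun_one_lt hβ hh hmax
  by_contra! hle
  exact hnot ⟨⟨h1, h2⟩, fun y hy => (hmax.2 y hy).trans hle⟩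

/-- Quadratic decay of `Hfun` away from a nondegenerate maximizer, on a set whose closure
contains no other maximizer. -/
lemma exists_Hfun_le_sub_sq {p : ℕ} {β h m : ℝ} (hβ : 0 < β) (hh : 0 < h)
    (hmax : isMaximizer p β h m) (hH : iteratedDeriv 2 (Hfun p β h) m < 0) {A : Set ℝ}
    (hA : ∀ x ∈ closure A, isMaximizer p β h x → x = m) :
    ∃ c > 0, ∀ x ∈ A ∩ Set.Icc (-1 : ℝ) 1, Hfun p β h x ≤ Hfun p β h m - c * (x - m) ^ 2 := by
  obtain ⟨K, hK, hev⟩ := exists_abs_Hfun_sub_le hmax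
  obtain ⟨ε, hε, hball⟩ := Metric.eventually_nhds_iff.1 hev
  set l := -iteratedDeriv 2 (Hfun p β h) m with hl
  have hl0 : 0 < l := by linarith
  have hH2 : iteratedDeriv 2 (Hfun p β h) m = -l := by linarith
  set r := min (ε / 2) (l / (4 * K)) with hr
  have hr0 : 0 < r := by positivity
  have hnear : ∀ x, |x - m| ≤ r → Hfun p β h x ≤ Hfun p β h m - l / 4 * (x - m) ^ 2 := by
    intro x hx
    have h1 := hball (y := x) (by
      rw [Real.dist_eq]; exact lt_of_le_of_lt (hx.trans (min_le_left _ _)) (by linarith))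
    rw [hH2] at h1
    have h2 : K * |x - m| ≤ l / 4 := by
      have := hx.trans (min_le_right _ _)
      rw [le_div_iff₀ (by positivity)] at this
      linarith
    have h3 : K * |x - m| ^ 3 ≤ l / 4 * (x - m) ^ 2 := by
      calc K * |x - m| ^ 3 = K * |x - m| * |x - m| ^ 2 := by ring
        _ ≤ l / 4 * |x - m| ^ 2 := by gcongr
        _ = _ := by rw [sq_abs]
    have := (abs_le.1 h1).2
    linarith
  set S := closure A ∩ Set.Icc (-1 : ℝ) 1 ∩ (Metric.ball m r)ᶜ with hS
  have hScomp : IsCompact S :=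
    ((isCompact_Icc.inter_left isClosed_closure).inter_right Metric.isOpen_ball.isClosed_compl)
  have hSlt : ∀ x ∈ S, Hfun p β h x < Hfun p β h m := by
    rintro x ⟨⟨hxA, hxI⟩, hxb⟩
    refine Hfun_lt_of_not_isMaximizer hβ hh hmax hxI fun hxm => ?_
    rw [hA x hxA hxm] at hxb
    exact hxb (Metric.mem_ball_self hr0)
  obtain ⟨δ, hδ, hfar⟩ : ∃ δ > 0, ∀ x ∈ S, Hfun p β h x ≤ Hfun p β h m - δ := by
    rcases S.eq_empty_or_nonempty with he | hne
    · exact ⟨1, one_pos, by simp [he]⟩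
    · obtain ⟨y, hyS, hy⟩ := hScomp.exists_isMaxOn hne (continuous_Hfun p β h).continuousOn
      exact ⟨Hfun p β h m - Hfun p β h y, sub_pos.2 (hSlt y hyS), fun x hx => by
        have : Hfun p β h x ≤ Hfun p β h y := hy hx
        linarith⟩
  refine ⟨min (l / 4) (δ / 4), by positivity, ?_⟩
  rintro x ⟨hxA, hxI⟩
  by_cases hx : |x - m| ≤ r
  · refine (hnear x hx).trans ?_
    have := mul_le_mul_of_nonneg_right (min_le_left (l / 4) (δ / 4)) (sq_nonneg (x - m))
    linarith
  · have h1 := hfar x ⟨⟨subset_closure hxA, hxI⟩, by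
      simp only [Set.mem_compl_iff, Metric.mem_ball, Real.dist_eq, not_lt]
      exact (not_le.1 hx).le⟩
    have h2 : (x - m) ^ 2 ≤ 4 := by
      have := hmax.1.1; have := hmax.1.2; have := hxI.1; have := hxI.2
      nlinarith
    have h3 := mul_le_mul (min_le_right (l / 4) (δ / 4)) h2 (sq_nonneg _) (by positivity)
    linarith

/-! ### Gaussian approximation of the weights -/

lemma abs_exp_sub_exp_le {a b B : ℝ} (ha : a ≤ B) (hb : b ≤ B) :
    |exp a - exp b| ≤ |a - b| * exp B := by
  wlog h : b ≤ a generalizing a b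
  · rw [abs_sub_comm, abs_sub_comm a]
    exact this hb ha (le_of_not_ge h)
  rw [abs_of_nonneg (sub_nonneg.2 (exp_le_exp.2 h)), abs_of_nonneg (sub_nonneg.2 h)]
  have h1 := add_one_le_exp (b - a)
  have h2 : exp b = exp a * exp (b - a) := by rw [← exp_add]; ring_nf
  have h3 := exp_le_exp.2 ha
  have h4 := mul_le_mul_of_nonneg_left h1 (exp_pos a).le
  have h5 := mul_le_mul_of_nonneg_left h3 (sub_nonneg.2 h)
  linarith

lemma one_add_add_cube_le_exp {c s : ℝ} (hc : 0 < c) (hs : 0 ≤ s) :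
    1 + s + s ^ 3 ≤ (3 + 1 / c + 2 / c ^ 2) * exp (c * s ^ 2) := by
  have h0 : 1 ≤ exp (c * s ^ 2) := one_le_exp (by positivity)
  have h1 : s ^ 2 ≤ 1 / c * exp (c * s ^ 2) := by
    rw [one_div, ← div_eq_inv_mul, le_div_iff₀ hc]
    linarith [add_one_le_exp (c * s ^ 2)]
  have h2 : s ^ 4 ≤ 2 / c ^ 2 * exp (c * s ^ 2) := by
    rw [div_mul_eq_mul_div, le_div_iff₀ (by positivity)]
    have := quadratic_le_exp_of_nonneg (x := c * s ^ 2) (by positivity)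
    nlinarith [mul_nonneg hc.le (sq_nonneg s)]
  have h3 : s ≤ 1 + s ^ 2 := by nlinarith [sq_nonneg (s - 1)]
  have h4 : s ^ 3 ≤ 1 + s ^ 4 := by nlinarith [sq_nonneg (s ^ 2 - s), sq_nonneg (s - 1), sq_nonneg s]
  linarith

/-- The leading-order size of the weight of the mean magnetization `m`. -/
def peakWeight (p : ℕ) (β h m : ℝ) (N : ℕ) : ℝ :=
  2 ^ N * exp (N * Hfun p β h m) * √(2 / (π * N * (1 - m ^ 2)))

lemma peakWeight_pos {p : ℕ} {β h m : ℝ} (hm : m ∈ Set.Ioo (-1 : ℝ) 1) {N : ℕ} (hN : 0 < N) :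
    0 < peakWeight p β h m N := by
  have : 0 < 1 - m ^ 2 := by nlinarith [hm.1, hm.2]
  unfold peakWeight
  positivity

/-- The total weight of the configurations with `k` positive spins, relative to `peakWeight`. -/
def relWeight (p : ℕ) (β h m : ℝ) (N k : ℕ) : ℝ :=
  N.choose k * exp (N * energy p β h (meanMag N k)) / peakWeight p β h m N

lemma relWeight_le {p : ℕ} {β h m : ℝ} (hm : m ∈ Set.Ioo (-1 : ℝ) 1) {N k : ℕ} (hN : 0 < N)
    (hk : k ≤ N) : relWeight p β h m N k ≤
      2 * √N * exp (N * (Hfun p β h (meanMag N k) - Hfun p β h m)) := by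
  have hm2 : 0 < 1 - m ^ 2 := by nlinarith [hm.1, hm.2]
  have hN' : (0 : ℝ) < N := by positivity
  rw [relWeight, div_le_iff₀ (peakWeight_pos hm hN)]
  calc (N.choose k : ℝ) * exp (N * energy p β h (meanMag N k))
      ≤ 2 ^ N * exp (-(N * binEnt (meanMag N k))) * exp (N * energy p β h (meanMag N k)) := by
        gcongr; exact choose_le_exp_binEnt hN hk
    _ = 2 ^ N * exp (N * Hfun p β h m) *
        exp (N * (Hfun p β h (meanMag N k) - Hfun p β h m)) * 1 := by
        rw [mul_assoc, ← exp_add, mul_assoc (2 ^ N : ℝ), ← exp_add, mul_one]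
        congr 2
        simp only [Hfun, energy]; ring
    _ ≤ 2 ^ N * exp (N * Hfun p β h m) *
        exp (N * (Hfun p β h (meanMag N k) - Hfun p β h m)) *
          (2 * √N * √(2 / (π * N * (1 - m ^ 2)))) := by
        gcongr
        have h4 : (2 : ℝ) = √4 := by rw [show (4 : ℝ) = 2 ^ 2 by norm_num]; simp
        nth_rewrite 1 [h4]
        rw [← sqrt_mul (by norm_num), ← sqrt_mul (by positivity), one_le_sqrt, mul_div_assoc',
          le_div_iff₀ (by positivity)]
        have : π * N * (1 - m ^ 2) ≤ 4 * N * 1 := by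
          gcongr
          · exact pi_le_four
          · nlinarith [sq_nonneg m]
        linarith
    _ = _ := by unfold peakWeight; ring

lemma relWeight_pos {p : ℕ} {β h m : ℝ} (hm : m ∈ Set.Ioo (-1 : ℝ) 1) {N k : ℕ} (hN : 0 < N)
    (hk : k ≤ N) : 0 < relWeight p β h m N k := by
  have := peakWeight_pos (p := p) (β := β) (h := h) hm hN
  have := Nat.choose_pos hk
  unfold relWeight
  positivity

lemma log_relWeight {p : ℕ} {β h m : ℝ} (hm : m ∈ Set.Ioo (-1 : ℝ) 1) {N k : ℕ} (hN : 0 < N)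
    (hk : k ≤ N) : log (relWeight p β h m N k) = log (N.choose k) +
      N * energy p β h (meanMag N k) - N * log 2 - N * Hfun p β h m -
        1 / 2 * log (2 / (π * N * (1 - m ^ 2))) := by
  have hm2 : 0 < 1 - m ^ 2 := by nlinarith [hm.1, hm.2]
  have := Nat.choose_pos hk
  rw [relWeight, peakWeight, log_div, log_mul, log_mul, log_mul, log_exp, log_exp, log_pow,
    log_sqrt] <;> first | positivity | ring

/-- The logarithm of the relative weight, near the maximizer. -/
lemma exists_abs_log_relWeight_sub_le {p : ℕ} {β h m : ℝ} (hmax : isMaximizer p β h m) :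
    ∃ K > 0, ∃ ε > 0, ε ≤ 1 ∧ ∀ N k : ℕ, 0 < N → k ≤ N → |meanMag N k - m| ≤ ε →
      |log (relWeight p β h m N k) - N * (Hfun p β h (meanMag N k) - Hfun p β h m)| ≤
        K * (|meanMag N k - m| + 1 / N) ∧
      |log (relWeight p β h m N k) - N * (iteratedDeriv 2 (Hfun p β h) m / 2 *
        (meanMag N k - m) ^ 2)| ≤ K * (N * |meanMag N k - m| ^ 3 + |meanMag N k - m| + 1 / N) := by
  obtain ⟨K₁, hK₁, hev₁⟩ := exists_abs_Hfun_sub_le hmax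
  have hm1 := hmax.1.1
  have hm2 := hmax.1.2
  have hmsq : 0 < 1 - m ^ 2 := by nlinarith
  have hdiff : DifferentiableAt ℝ (fun x : ℝ => log (1 - x ^ 2)) m :=
    DifferentiableAt.log (by fun_prop) hmsq.ne'
  obtain ⟨K₂, hK₂, hev₂⟩ := hdiff.isBigO_sub.exists_pos
  obtain ⟨ε, hε, hball⟩ := Metric.eventually_nhds_iff.1 (hev₁.and hev₂.bound)
  set r := min (1 + m) (1 - m) / 2 with hr
  have hr0 : 0 < r := by
    have : 0 < min (1 + m) (1 - m) := lt_min (by linarith) (by linarith)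
    positivity
  have hr1 : 2 * r ≤ 1 + m := by rw [hr]; linarith [min_le_left (1 + m) (1 - m)]
  have hr2 : 2 * r ≤ 1 - m := by rw [hr]; linarith [min_le_right (1 + m) (1 - m)]
  set K := K₁ + K₂ + (1 + 4 / r) with hK
  have hK0 : 0 < K := by positivity
  refine ⟨K, hK0, min (ε / 2) (min r 1), by positivity,
    (min_le_right _ _).trans (min_le_right _ _), ?_⟩
  intro N k hN hk hd
  set x := meanMag N k with hx
  have hN' : (0 : ℝ) < N := by positivity
  obtain ⟨hT, hL⟩ := hball (y := x) (by
    rw [Real.dist_eq]; exact lt_of_le_of_lt (hd.trans (min_le_left _ _)) (by linarith))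
  have hdr : |x - m| ≤ r := hd.trans ((min_le_right _ _).trans (min_le_left _ _))
  have hxr1 : r ≤ 1 + x := by linarith [(abs_le.1 hdr).1]
  have hxr2 : r ≤ 1 - x := by linarith [(abs_le.1 hdr).2]
  have hxsq : 0 < 1 - x ^ 2 := by
    rw [show 1 - x ^ 2 = (1 + x) * (1 - x) by ring]
    exact mul_pos (by linarith) (by linarith)
  have hkr : r * N / 2 ≤ k := by
    rw [one_add_meanMag hN, mul_div_assoc', le_div_iff₀ hN'] at hxr1
    linarith
  have hlr : r * N / 2 ≤ (N - k : ℕ) := by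
    rw [one_sub_meanMag hN hk, mul_div_assoc', le_div_iff₀ hN'] at hxr2
    linarith
  have hk0 : 0 < k := by
    have : (0 : ℝ) < k := lt_of_lt_of_le (by positivity) hkr
    exact_mod_cast this
  have hkN : k < N := by
    have : (0 : ℝ) < (N - k : ℕ) := lt_of_lt_of_le (by positivity) hlr
    have : 0 < N - k := by exact_mod_cast this
    omega
  have hS := abs_log_choose_sub_le hk0 hkN
  rw [← hx] at hS
  have hinv : ∀ y : ℝ, r * N / 2 ≤ y → 1 / y ≤ 2 / r * (1 / N) := by
    intro y hy
    calc 1 / y ≤ 1 / (r * N / 2) := one_div_le_one_div_of_le (by positivity) hy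
      _ = _ := by field_simp
  have hS2 : 1 / (N : ℝ) + 1 / k + 1 / (N - k : ℕ) ≤ (1 + 4 / r) * (1 / N) := by
    have e : (1 + 4 / r) * (1 / (N : ℝ)) = 1 / N + 2 / r * (1 / N) + 2 / r * (1 / N) := by ring
    linarith [hinv _ hkr, hinv _ hlr]
  have hlog : ∀ y : ℝ, 0 < 1 - y ^ 2 → log (2 / (π * N * (1 - y ^ 2))) =
      log 2 - log (π * N) - log (1 - y ^ 2) := by
    intro y hy
    rw [log_div two_ne_zero (by positivity), log_mul (by positivity) hy.ne']
    ring
  have hL' : |log (1 - x ^ 2) - log (1 - m ^ 2)| ≤ K₂ * |x - m| := by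
    simpa only [norm_eq_abs] using hL
  have hlogW := log_relWeight (p := p) (β := β) (h := h) hmax.1 hN hk
  rw [hlog m hmsq, ← hx] at hlogW
  rw [hlog x hxsq] at hS
  have hH : Hfun p β h x = energy p β h x - binEnt x := rfl
  have hfirst : |log (relWeight p β h m N k) - N * (Hfun p β h x - Hfun p β h m)| ≤
      (1 + 4 / r) * (1 / N) + K₂ * |x - m| := by
    rw [hlogW, hH]
    have hS' := hS.trans hS2
    rw [abs_le] at hS' hL' ⊢
    obtain ⟨a1, a2⟩ := hS'
    obtain ⟨b1, b2⟩ := hL'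
    have : 0 ≤ K₂ * |x - m| := by positivity
    constructor <;> linarith
  have p1 : 0 ≤ |x - m| := abs_nonneg _
  have p2 : (0 : ℝ) < 1 / N := by positivity
  have p3 : 0 ≤ (N : ℝ) * |x - m| ^ 3 := by positivity
  have p4 : 0 ≤ 1 + 4 / r := by positivity
  have hKle : K₁ ≤ K ∧ K₂ ≤ K ∧ (1 + 4 / r) ≤ K := by
    refine ⟨?_, ?_, ?_⟩ <;> rw [hK] <;> linarith
  have q1 := mul_le_mul_of_nonneg_right hKle.1 p3
  have q2 := mul_le_mul_of_nonneg_right hKle.2.1 p1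
  have q3 := mul_le_mul_of_nonneg_right hKle.2.2 p2.le
  refine ⟨by linarith, ?_⟩
  have hT' := mul_le_mul_of_nonneg_left hT hN'.le
  nth_rewrite 1 [← abs_of_pos hN'] at hT'
  rw [← abs_mul] at hT'
  rw [abs_le] at hfirst hT' ⊢
  constructor <;> linarith [hfirst.1, hfirst.2, hT'.1, hT'.2]

set_option maxHeartbeats 1000000 in
/-- Pointwise comparison of the relative weights with a Gaussian profile. -/
lemma exists_abs_relWeight_sub_gaussian_le {p : ℕ} {β h m : ℝ} (hβ : 0 < β) (hh : 0 < h)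
    (hmax : isMaximizer p β h m) (hH : iteratedDeriv 2 (Hfun p β h) m < 0) {A : Set ℝ}
    [DecidablePred (· ∈ A)] (hAopen : IsOpen A) (hmA : m ∈ A)
    (hA : ∀ x ∈ closure A, isMaximizer p β h x → x = m) :
    ∃ c > 0, ∃ K > 0, ∀ N k : ℕ, 0 < N → k ≤ N →
      |(if meanMag N k ∈ A then relWeight p β h m N k else 0) -
        exp (N * (iteratedDeriv 2 (Hfun p β h) m / 2 * (meanMag N k - m) ^ 2))| ≤
      K / √N * exp (-c * (N * (meanMag N k - m) ^ 2)) := by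
  set l := -iteratedDeriv 2 (Hfun p β h) m with hl
  have hl0 : 0 < l := by linarith
  have hH2 : iteratedDeriv 2 (Hfun p β h) m = -l := by linarith
  obtain ⟨c₀, hc₀, hdecay⟩ := exists_Hfun_le_sub_sq hβ hh hmax hH hA
  obtain ⟨K, hK, ε₁, hε₁, hε₁le, hlog⟩ := exists_abs_log_relWeight_sub_le hmax
  obtain ⟨ε₂, hε₂, hballA⟩ := Metric.isOpen_iff.1 hAopen m hmA
  set c := min c₀ (l / 2) / 2 with hc
  have hcpos : 0 < c := by positivity
  have hc1 : 2 * c ≤ c₀ := by rw [hc]; linarith [min_le_left c₀ (l / 2)]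
  have hc2 : 2 * c ≤ l / 2 := by rw [hc]; linarith [min_le_right c₀ (l / 2)]
  set ε := min ε₁ (ε₂ / 2) with hε
  have hε0 : 0 < ε := by positivity
  set P := 3 + 1 / c + 2 / c ^ 2 with hP
  have hP0 : 0 < P := by positivity
  set K' := 2 / (c * ε ^ 2) + K * P * exp (2 * K) with hK'
  have hfar0 : 0 < 2 / (c * ε ^ 2) := by positivity
  have hnear0 : 0 < K * P * exp (2 * K) := by positivity
  refine ⟨c, hcpos, K', by positivity, ?_⟩
  intro N k hN hk
  rw [hH2] at hlog ⊢
  have hN' : (0 : ℝ) < N := by positivity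
  have hN1 : (1 : ℝ) ≤ N := by exact_mod_cast hN
  have hlogN := hlog N k hN hk
  have hxI := meanMag_mem_Icc hN hk
  have hWpos := relWeight_pos (p := p) (β := β) (h := h) hmax.1 hN hk
  have hWle := relWeight_le (p := p) (β := β) (h := h) hmax.1 hN hk
  set x := meanMag N k with hx
  set W := relWeight p β h m N k with hW
  set q := (N : ℝ) * (x - m) ^ 2 with hq
  have hq0 : 0 ≤ q := by positivity
  have hgq : (N : ℝ) * (-l / 2 * (x - m) ^ 2) = -(l / 2) * q := by rw [hq]; ring
  rw [hgq] at hlogN ⊢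
  have hsN : 0 < √(N : ℝ) := by positivity
  have hsN1 : 1 ≤ √(N : ℝ) := one_le_sqrt.2 hN1
  have hsNsq : √(N : ℝ) * √N = N := mul_self_sqrt hN'.le
  have hHq : x ∈ A → N * (Hfun p β h x - Hfun p β h m) ≤ -(2 * c) * q := by
    intro hxA
    have h1 := mul_le_mul_of_nonneg_left (hdecay x ⟨hxA, hxI⟩) hN'.le
    have h2 := mul_le_mul_of_nonneg_right hc1 hq0
    rw [hq] at h2 ⊢
    linarith
  have hlq : -(l / 2) * q ≤ -(2 * c) * q := by
    have := mul_le_mul_of_nonneg_right hc2 hq0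
    linarith
  by_cases hd : |x - m| ≤ ε
  · have hxA : x ∈ A := by
      refine hballA ?_
      rw [Metric.mem_ball, Real.dist_eq]
      exact lt_of_le_of_lt (hd.trans (min_le_right _ _)) (by linarith)
    rw [if_pos hxA]
    obtain ⟨h1, h2⟩ := hlogN (hd.trans (min_le_left _ _))
    set s := √(N : ℝ) * |x - m| with hs
    have hs0 : 0 ≤ s := by positivity
    have hsq : s ^ 2 = q := by
      rw [hs, mul_pow, sq_abs, sq_sqrt hN'.le]
    have hdx : |x - m| ≤ 1 := hd.trans ((min_le_left _ _).trans hε₁le)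
    have hKb : K * (|x - m| + 1 / N) ≤ 2 * K := by
      have : 1 / (N : ℝ) ≤ 1 := by rw [div_le_one hN']; exact hN1
      have := mul_le_mul_of_nonneg_left (add_le_add hdx this) hK.le
      linarith
    have hupper : log W ≤ 2 * K + -(2 * c) * q := by
      have := (abs_le.1 h1).2
      linarith [hHq hxA]
    have h3 := abs_exp_sub_exp_le hupper
      (show -(l / 2) * q ≤ 2 * K + -(2 * c) * q by linarith)
    rw [exp_log hWpos] at h3
    have hpoly : N * |x - m| ^ 3 + |x - m| + 1 / N ≤ 1 / √N * (1 + s + s ^ 3) := by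
      have e1 : (N : ℝ) * |x - m| ^ 3 = 1 / √N * s ^ 3 := by
        rw [hs, mul_pow]; field_simp; rw [sq_sqrt hN'.le]; ring
      have e2 : |x - m| = 1 / √N * s := by rw [hs]; field_simp
      have e3 : 1 / (N : ℝ) ≤ 1 / √N := by
        refine one_div_le_one_div_of_le hsN ?_
        have := le_mul_of_one_le_left hsN.le hsN1
        rwa [hsNsq] at this
      rw [e1]; nth_rewrite 1 [e2]
      linarith
    have hpe := one_add_add_cube_le_exp hcpos hs0
    rw [hsq] at hpe
    calc |W - exp (-(l / 2) * q)|
        ≤ |log W - -(l / 2) * q| * exp (2 * K + -(2 * c) * q) := h3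
      _ ≤ K * (1 / √N * (P * exp (c * q))) * exp (2 * K + -(2 * c) * q) := by
          gcongr
          refine h2.trans ?_
          gcongr
          refine hpoly.trans ?_
          gcongr
      _ = K * P * exp (2 * K) / √N * exp (-c * q) := by
          rw [show 2 * K + -(2 * c) * q = 2 * K + (-c * q + -(c * q)) by ring, exp_add, exp_add,
            exp_neg (c * q)]
          field_simp
      _ ≤ K' / √N * exp (-c * q) := by
          gcongr; rw [hK']; linarith
  · have hqε : ε ^ 2 * N ≤ q := by
      rw [hq, mul_comm, ← sq_abs (x - m)]
      have := (not_le.1 hd).le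
      gcongr
    have hbound : 2 * √N * exp (-(2 * c) * q) ≤ 2 / (c * ε ^ 2) / √N * exp (-c * q) := by
      rw [show -(2 * c) * q = -c * q + -(c * q) by ring, exp_add, exp_neg (c * q)]
      have h1 : c * ε ^ 2 * N ≤ exp (c * q) := by
        have := add_one_le_exp (c * q)
        have := mul_le_mul_of_nonneg_left hqε hcpos.le
        linarith
      have h2 : √(N : ℝ) * (exp (c * q))⁻¹ ≤ 1 / (c * ε ^ 2) / √N := by
        rw [div_div, le_div_iff₀ (by positivity), mul_comm, ← mul_assoc, ← div_eq_mul_inv,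
          div_le_one (exp_pos _)]
        calc c * ε ^ 2 * √N * √N = c * ε ^ 2 * N := by rw [mul_assoc, hsNsq]
          _ ≤ _ := h1
      calc 2 * √N * (exp (-c * q) * (exp (c * q))⁻¹)
          = 2 * (√N * (exp (c * q))⁻¹) * exp (-c * q) := by ring
        _ ≤ 2 * (1 / (c * ε ^ 2) / √N) * exp (-c * q) := by gcongr
        _ = _ := by ring
    have hg : exp (-(l / 2) * q) ≤ 2 * √N * exp (-(2 * c) * q) := by
      refine (exp_le_exp.2 hlq).trans (le_mul_of_one_le_left (exp_pos _).le ?_)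
      linarith
    have hu : (if x ∈ A then W else 0) ≤ 2 * √N * exp (-(2 * c) * q) := by
      split_ifs with hxA
      · refine hWle.trans ?_
        exact mul_le_mul_of_nonneg_left (exp_le_exp.2 (hHq hxA)) (by positivity)
      · positivity
    have hu0 : 0 ≤ (if x ∈ A then W else 0) := by split_ifs <;> [exact hWpos.le; exact le_rfl]
    calc |(if x ∈ A then W else 0) - exp (-(l / 2) * q)|
        ≤ 2 * √N * exp (-(2 * c) * q) :=
          abs_sub_le_of_nonneg_of_le hu0 hu (exp_pos _).le hg
      _ ≤ 2 / (c * ε ^ 2) / √N * exp (-c * q) := hbound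
      _ ≤ K' / √N * exp (-c * q) := by
          gcongr; rw [hK']; linarith

/-! ### Riemann sums of the Gaussian density -/

/-- The unnormalized standard Gaussian distribution function. -/
def gaussPrimitive (y : ℝ) : ℝ := ∫ t in Set.Iic y, exp (-t ^ 2 / 2)

lemma integrable_exp_neg_sq_div_two : Integrable fun t : ℝ => exp (-t ^ 2 / 2) := by
  refine (integrable_exp_neg_mul_sq (b := 1 / 2) (by norm_num)).congr (ae_of_all _ fun t => ?_)
  ring_nf

lemma integral_exp_neg_sq_div_two : ∫ t : ℝ, exp (-t ^ 2 / 2) = √(2 * π) := by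
  have := integral_gaussian (1 / 2)
  rw [show π / (1 / 2) = 2 * π by ring] at this
  rw [← this]
  refine integral_congr_ae (ae_of_all _ fun t => ?_)
  simp only
  congr 1; ring

lemma stdNormCDF_eq (y : ℝ) : stdNormCDF y = gaussPrimitive y / √(2 * π) := by
  rw [stdNormCDF, gaussCDF, gaussProb, gaussPrimitive, integral_const_mul, div_eq_inv_mul]
  simp

lemma gaussPrimitive_nonneg (y : ℝ) : 0 ≤ gaussPrimitive y :=
  integral_nonneg fun _ => (exp_pos _).le

lemma gaussPrimitive_sub (a b : ℝ) :
    gaussPrimitive b - gaussPrimitive a = ∫ t in a..b, exp (-t ^ 2 / 2) :=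
  intervalIntegral.integral_Iic_sub_Iic integrable_exp_neg_sq_div_two.integrableOn
    integrable_exp_neg_sq_div_two.integrableOn

lemma gaussPrimitive_mono : Monotone gaussPrimitive := fun a b hab => by
  rw [← sub_nonneg, gaussPrimitive_sub]
  exact intervalIntegral.integral_nonneg hab fun _ _ => (exp_pos _).le

lemma gaussPrimitive_sub_le {a b : ℝ} (hab : a ≤ b) :
    gaussPrimitive b - gaussPrimitive a ≤ b - a := by
  rw [gaussPrimitive_sub]
  calc ∫ t in a..b, exp (-t ^ 2 / 2) ≤ ∫ _t in a..b, (1 : ℝ) := by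
        refine intervalIntegral.integral_mono hab
          (integrable_exp_neg_sq_div_two.intervalIntegrable) (by simp) fun t => ?_
        simp only [exp_le_one_iff]
        nlinarith [sq_nonneg t]
    _ = b - a := by simp

lemma sqrt_two_pi_sub_gaussPrimitive (y : ℝ) :
    √(2 * π) - gaussPrimitive y = ∫ t in Set.Ioi y, exp (-t ^ 2 / 2) := by
  rw [← integral_exp_neg_sq_div_two, gaussPrimitive,
    ← intervalIntegral.integral_Iic_add_Ioi (b := y) integrable_exp_neg_sq_div_two.integrableOn
      integrable_exp_neg_sq_div_two.integrableOn]
  ring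

lemma gaussPrimitive_le (y : ℝ) : gaussPrimitive y ≤ √(2 * π) := by
  rw [← sub_nonneg, sqrt_two_pi_sub_gaussPrimitive]
  exact integral_nonneg fun _ => (exp_pos _).le

lemma exists_gaussian_tail_le : ∃ C > 0, ∀ T > 0, gaussPrimitive (-T) ≤ C / T ∧
    √(2 * π) - gaussPrimitive T ≤ C / T := by
  have hint : Integrable fun t : ℝ => |t| * exp (-t ^ 2 / 2) := by
    refine (integrable_mul_exp_neg_mul_sq (b := 1 / 2) (by norm_num)).abs.congr
      (ae_of_all _ fun t => ?_)
    simp only [abs_mul, abs_exp]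
    congr 2; ring
  have hnn : ∀ t : ℝ, 0 ≤ |t| * exp (-t ^ 2 / 2) := fun t => by positivity
  have h0 : 0 ≤ ∫ t : ℝ, |t| * exp (-t ^ 2 / 2) := integral_nonneg hnn
  have key : ∀ T > 0, ∀ S : Set ℝ, MeasurableSet S → (∀ t ∈ S, T ≤ |t|) →
      ∫ t in S, exp (-t ^ 2 / 2) ≤ (1 + ∫ t : ℝ, |t| * exp (-t ^ 2 / 2)) / T := by
    intro T hT S hS hTS
    rw [le_div_iff₀ hT, ← integral_mul_const]
    calc ∫ t in S, exp (-t ^ 2 / 2) * T ≤ ∫ t in S, |t| * exp (-t ^ 2 / 2) := by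
          refine setIntegral_mono_on (integrable_exp_neg_sq_div_two.mul_const T).integrableOn
            hint.integrableOn hS fun t ht => ?_
          rw [mul_comm]
          exact mul_le_mul_of_nonneg_right (hTS t ht) (exp_pos _).le
      _ ≤ ∫ t : ℝ, |t| * exp (-t ^ 2 / 2) :=
          setIntegral_le_integral hint (ae_of_all _ hnn)
      _ ≤ _ := by linarith
  refine ⟨_, add_pos_of_pos_of_nonneg one_pos h0, fun T hT => ⟨?_, ?_⟩⟩
  · refine key T hT _ measurableSet_Iic fun t ht => ?_
    rw [Set.mem_Iic] at ht
    rw [abs_of_neg (by linarith)]; linarith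
  · rw [sqrt_two_pi_sub_gaussPrimitive]
    refine key T hT _ measurableSet_Ioi fun t ht => ?_
    exact (Set.mem_Ioi.1 ht).le.trans (le_abs_self t)

lemma exists_abs_sub_gaussian_le_of_near {c K : ℝ} (hc : 0 < c) (hK : 0 < K) :
    ∃ C > 0, ∃ c' > 0, ∀ Δ s t u : ℝ, Δ ≤ 2 → s ≤ t → t ≤ s + Δ →
      |u - exp (-s ^ 2 / 2)| ≤ K * Δ * exp (-c * s ^ 2) →
      |u - exp (-t ^ 2 / 2)| ≤ C * Δ * exp (-c' * t ^ 2) := by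
  set P : ℝ := 3 + 1 / (1 / 8) + 2 / (1 / 8) ^ 2 with hP
  have hP0 : 0 < P := by positivity
  refine ⟨P * exp 2 + K * exp (4 * c), by positivity, min (c / 2) (1 / 8), by positivity, ?_⟩
  intro Δ s t u hΔ hst hts hu
  set c' := min (c / 2) (1 / 8) with hc'
  have hΔ0 : 0 ≤ Δ := by linarith
  have hsq : t ^ 2 ≤ 2 * s ^ 2 + 8 := by
    have : (t - s) ^ 2 ≤ 4 := by nlinarith
    nlinarith [sq_nonneg (t - 2 * s)]
  have h1 : |exp (-s ^ 2 / 2) - exp (-t ^ 2 / 2)| ≤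
      |-s ^ 2 / 2 - -t ^ 2 / 2| * exp (2 + -(t ^ 2 / 4)) :=
    abs_exp_sub_exp_le (by linarith) (by nlinarith [sq_nonneg t])
  have h2 : |-s ^ 2 / 2 - -t ^ 2 / 2| ≤ Δ * (1 + |t| + |t| ^ 3) := by
    rw [show -s ^ 2 / 2 - -t ^ 2 / 2 = (t - s) * (t - (t - s) / 2) by ring, abs_mul,
      abs_of_nonneg (sub_nonneg.2 hst)]
    have h3 : |t - (t - s) / 2| ≤ 1 + |t| + |t| ^ 3 := by
      have := abs_sub t ((t - s) / 2)
      rw [abs_of_nonneg (a := (t - s) / 2) (by linarith)] at this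
      have : 0 ≤ |t| ^ 3 := by positivity
      linarith
    exact mul_le_mul (by linarith) h3 (abs_nonneg _) hΔ0
  have h4 := one_add_add_cube_le_exp (c := 1 / 8) (by norm_num) (abs_nonneg t)
  rw [sq_abs, ← hP] at h4
  have h5 : |exp (-s ^ 2 / 2) - exp (-t ^ 2 / 2)| ≤ P * exp 2 * Δ * exp (-c' * t ^ 2) := by
    calc |exp (-s ^ 2 / 2) - exp (-t ^ 2 / 2)|
        ≤ Δ * (P * exp (1 / 8 * t ^ 2)) * exp (2 + -(t ^ 2 / 4)) := by
          refine h1.trans ?_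
          gcongr
          exact h2.trans (by gcongr)
      _ = P * exp 2 * Δ * exp (-(1 / 8) * t ^ 2) := by
          rw [exp_add, show -(1 / 8) * t ^ 2 = 1 / 8 * t ^ 2 + -(t ^ 2 / 4) by ring, exp_add]
          ring
      _ ≤ _ := by
          gcongr
          exact min_le_right _ _
  have h6 : K * Δ * exp (-c * s ^ 2) ≤ K * exp (4 * c) * Δ * exp (-c' * t ^ 2) := by
    calc K * Δ * exp (-c * s ^ 2) ≤ K * Δ * exp (4 * c + -(c / 2) * t ^ 2) := by
          gcongr
          nlinarith
      _ = K * exp (4 * c) * Δ * exp (-(c / 2) * t ^ 2) := by rw [exp_add]; ring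
      _ ≤ _ := by
          gcongr
          exact min_le_left _ _
  calc |u - exp (-t ^ 2 / 2)| ≤ |u - exp (-s ^ 2 / 2)| +
        |exp (-s ^ 2 / 2) - exp (-t ^ 2 / 2)| := abs_sub_le _ _ _
    _ ≤ K * exp (4 * c) * Δ * exp (-c' * t ^ 2) + P * exp 2 * Δ * exp (-c' * t ^ 2) :=
        add_le_add (hu.trans h6) h5
    _ = _ := by ring

lemma exists_abs_riemann_sum_sub_le {c K : ℝ} (hc : 0 < c) (hK : 0 < K) :
    ∃ C > 0, ∀ (Δ t₀ : ℝ) (u : ℕ → ℝ) (n : ℕ), 0 < Δ → Δ ≤ 2 →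
      (∀ k < n, |u k - exp (-(t₀ + k * Δ) ^ 2 / 2)| ≤ K * Δ * exp (-c * (t₀ + k * Δ) ^ 2)) →
      |Δ * ∑ k ∈ Finset.range n, u k -
        (gaussPrimitive (t₀ + n * Δ) - gaussPrimitive t₀)| ≤ C * Δ := by
  obtain ⟨C, hC, c', hc', hnear⟩ := exists_abs_sub_gaussian_le_of_near hc hK
  have hint : Integrable fun t : ℝ => exp (-c' * t ^ 2) := integrable_exp_neg_mul_sq hc'
  have hI : 0 < ∫ t : ℝ, exp (-c' * t ^ 2) := by rw [integral_gaussian]; positivity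
  refine ⟨C * ∫ t : ℝ, exp (-c' * t ^ 2), by positivity, ?_⟩
  intro Δ t₀ u n hΔ0 hΔ2 hu
  have hstep : ∀ k : ℕ, t₀ + ((k + 1 : ℕ) : ℝ) * Δ = t₀ + k * Δ + Δ := by
    intro k; push_cast; ring
  have hmono : ∀ k : ℕ, t₀ + k * Δ ≤ t₀ + ((k + 1 : ℕ) : ℝ) * Δ := by
    intro k; rw [hstep]; linarith
  have hg : ∀ a b : ℝ, IntervalIntegrable (fun t : ℝ => exp (-t ^ 2 / 2)) volume a b :=
    fun a b => integrable_exp_neg_sq_div_two.intervalIntegrable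
  have hsum : ∑ k ∈ Finset.range n, ∫ t in (t₀ + (k : ℝ) * Δ)..(t₀ + ((k + 1 : ℕ) : ℝ) * Δ),
      exp (-t ^ 2 / 2) = gaussPrimitive (t₀ + n * Δ) - gaussPrimitive t₀ := by
    rw [intervalIntegral.sum_integral_adjacent_intervals (a := fun k : ℕ => t₀ + (k : ℝ) * Δ)
      (fun k _ => hg _ _), gaussPrimitive_sub]
    simp
  have hsum' : ∑ k ∈ Finset.range n, ∫ t in (t₀ + (k : ℝ) * Δ)..(t₀ + ((k + 1 : ℕ) : ℝ) * Δ),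
      C * Δ * exp (-c' * t ^ 2) ≤ C * (∫ t : ℝ, exp (-c' * t ^ 2)) * Δ := by
    have hle : t₀ ≤ t₀ + n * Δ := by
      have : (0 : ℝ) ≤ n * Δ := by positivity
      linarith
    rw [intervalIntegral.sum_integral_adjacent_intervals (a := fun k : ℕ => t₀ + (k : ℝ) * Δ)
      (fun k _ => (hint.const_mul (C * Δ)).intervalIntegrable), intervalIntegral.integral_const_mul]
    simp only [Nat.cast_zero, zero_mul, add_zero]
    rw [intervalIntegral.integral_of_le hle]
    have := setIntegral_le_integral (s := Set.Ioc t₀ (t₀ + n * Δ)) hint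
      (ae_of_all _ fun t => (exp_pos _).le)
    calc C * Δ * ∫ t in Set.Ioc t₀ (t₀ + n * Δ), exp (-c' * t ^ 2)
        ≤ C * Δ * ∫ t : ℝ, exp (-c' * t ^ 2) := by gcongr
      _ = _ := by ring
  rw [← hsum, Finset.mul_sum, ← Finset.sum_sub_distrib]
  refine (Finset.abs_sum_le_sum_abs _ _).trans ((Finset.sum_le_sum fun k hk => ?_).trans hsum')
  have hcell : Δ * u k - ∫ t in (t₀ + (k : ℝ) * Δ)..(t₀ + ((k + 1 : ℕ) : ℝ) * Δ),
      exp (-t ^ 2 / 2) = ∫ t in (t₀ + (k : ℝ) * Δ)..(t₀ + ((k + 1 : ℕ) : ℝ) * Δ),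
        (u k - exp (-t ^ 2 / 2)) := by
    rw [intervalIntegral.integral_sub (by simp) (hg _ _), intervalIntegral.integral_const, hstep]
    simp
  rw [hcell, ← norm_eq_abs]
  refine intervalIntegral.norm_integral_le_of_norm_le (hmono k) (ae_of_all _ fun t ht => ?_)
    (hint.const_mul (C * Δ)).intervalIntegrable
  rw [hstep] at ht
  exact hnear Δ (t₀ + k * Δ) t (u k) hΔ2 ht.1.le ht.2 (hu k (Finset.mem_range.1 hk))

lemma exists_filter_range_eq_range {t : ℕ → ℝ} (ht : Monotone t) (n : ℕ) (y : ℝ) :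
    ∃ j ≤ n, (Finset.range n).filter (fun k => t k ≤ y) = Finset.range j ∧
      (∀ k < j, t k ≤ y) ∧ (j < n → y < t j) := by
  classical
  have hex : ∃ j, n ≤ j ∨ y < t j := ⟨n, Or.inl le_rfl⟩
  have hmin : ∀ k < Nat.find hex, k < n ∧ t k ≤ y := fun k hk => by
    simpa using Nat.find_min hex hk
  refine ⟨Nat.find hex, Nat.find_min' hex (Or.inl le_rfl), ?_, fun k hk => (hmin k hk).2,
    fun hj => (Nat.find_spec hex).resolve_left (not_le.2 hj)⟩
  ext k
  simp only [Finset.mem_filter, Finset.mem_range]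
  refine ⟨fun ⟨hkn, hky⟩ => ?_, hmin k⟩
  by_contra! hk
  exact ((Nat.find_spec hex).resolve_left (by omega)).not_ge ((ht hk).trans hky)

lemma exists_abs_lattice_sum_sub_gaussPrimitive_le {c K a : ℝ} (hc : 0 < c) (hK : 0 < K)
    (ha : 0 < a) :
    ∃ C > 0, ∀ (Δ t₀ : ℝ) (u : ℕ → ℝ) (n : ℕ), 0 < Δ → Δ ≤ 2 → t₀ ≤ -(a / Δ) →
      a / Δ ≤ t₀ + n * Δ →
      (∀ k < n + 1, |u k - exp (-(t₀ + k * Δ) ^ 2 / 2)| ≤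
        K * Δ * exp (-c * (t₀ + k * Δ) ^ 2)) →
      |Δ * ∑ k ∈ Finset.range (n + 1), u k - √(2 * π)| ≤ C * Δ ∧
      ∀ y, |Δ * ∑ k ∈ (Finset.range (n + 1)).filter (fun k : ℕ => t₀ + k * Δ ≤ y), u k -
        gaussPrimitive y| ≤ C * Δ := by
  obtain ⟨C₁, hC₁, hsum⟩ := exists_abs_riemann_sum_sub_le hc hK
  obtain ⟨C₂, hC₂, htail⟩ := exists_gaussian_tail_le
  refine ⟨C₁ + 1 + 2 * (C₂ / a), by positivity, ?_⟩
  intro Δ t₀ u n hΔ0 hΔ2 ht₀ htn hu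
  obtain ⟨hl, hr⟩ := htail (a / Δ) (by positivity)
  have hτ : C₂ / (a / Δ) = C₂ / a * Δ := by field_simp
  rw [hτ] at hl hr
  have hτ0 : 0 ≤ C₂ / a * Δ := by positivity
  have hlow : gaussPrimitive t₀ ≤ C₂ / a * Δ := (gaussPrimitive_mono ht₀).trans hl
  have hhigh : √(2 * π) - C₂ / a * Δ ≤ gaussPrimitive (t₀ + n * Δ) := by
    linarith [gaussPrimitive_mono htn]
  have hlow0 := gaussPrimitive_nonneg t₀
  have hmono : Monotone fun k : ℕ => t₀ + (k : ℝ) * Δ := fun i j hij => by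
    have : (i : ℝ) ≤ j := by exact_mod_cast hij
    simp only; gcongr
  have hlast : √(2 * π) - C₂ / a * Δ ≤ gaussPrimitive (t₀ + (n + 1 : ℕ) * Δ) :=
    hhigh.trans (gaussPrimitive_mono (hmono (Nat.le_succ n)))
  have hfin : ∀ {X Y Z : ℝ}, |X - Y| ≤ C₁ * Δ → |Y - Z| ≤ (1 + 2 * (C₂ / a)) * Δ →
      |X - Z| ≤ (C₁ + 1 + 2 * (C₂ / a)) * Δ := fun {X Y Z} h1 h2 => by
    linarith [abs_sub_le X Y Z]
  refine ⟨?_, fun y => ?_⟩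
  · refine hfin (hsum Δ t₀ u (n + 1) hΔ0 hΔ2 hu) ?_
    have := gaussPrimitive_le (t₀ + (n + 1 : ℕ) * Δ)
    rw [abs_le]
    constructor <;> linarith
  · obtain ⟨j, hjn, hfil, hle, hlt⟩ := exists_filter_range_eq_range hmono (n + 1) y
    rw [hfil]
    refine hfin (hsum Δ t₀ u j hΔ0 hΔ2 fun k hk => hu k (by omega)) ?_
    have hy0 := gaussPrimitive_nonneg y
    rcases Nat.eq_zero_or_pos j with rfl | hj
    · have h1 := gaussPrimitive_mono (hlt (by omega)).le
      simp only [Nat.cast_zero, zero_mul, add_zero] at h1 ⊢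
      rw [abs_le]
      constructor <;> linarith
    · have h1 := gaussPrimitive_mono (hle (j - 1) (by omega))
      have h2 := gaussPrimitive_sub_le (hmono (Nat.sub_le j 1))
      have h3 : t₀ + (j : ℝ) * Δ - (t₀ + ((j - 1 : ℕ) : ℝ) * Δ) = Δ := by
        rw [Nat.cast_sub hj]; push_cast; ring
      rw [h3] at h2
      have h4 : gaussPrimitive y - C₂ / a * Δ ≤ gaussPrimitive (t₀ + j * Δ) := by
        rcases hjn.lt_or_eq with hj' | rfl
        · linarith [gaussPrimitive_mono (hlt hj').le]
        · linarith [gaussPrimitive_le y]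
      simp only at h1 h2
      rw [abs_le]
      constructor <;> linarith

lemma abs_div_sub_div_le {F T G M δ : ℝ} (hM : 0 < M) (hG : 0 ≤ G) (hGM : G ≤ M)
    (hF : |F - G| ≤ δ) (hT : |T - M| ≤ δ) (hδ : δ ≤ M / 2) :
    |F / T - G / M| ≤ 4 / M * δ := by
  have hTM : M / 2 ≤ T := by linarith [(abs_le.1 hT).1]
  have hT0 : 0 < T := by linarith
  have hδ0 : 0 ≤ δ := (abs_nonneg _).trans hF
  have h1 : F / T - G / M = ((F - G) * M - G * (T - M)) / (T * M) := by field_simp; ring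
  have h2 : |(F - G) * M - G * (T - M)| ≤ 2 * δ * M := by
    calc |(F - G) * M - G * (T - M)| ≤ |(F - G) * M| + |G * (T - M)| := abs_sub _ _
      _ = |F - G| * M + G * |T - M| := by rw [abs_mul, abs_mul, abs_of_pos hM, abs_of_nonneg hG]
      _ ≤ δ * M + M * δ := by gcongr
      _ = _ := by ring
  rw [h1, abs_div, abs_of_pos (mul_pos hT0 hM), div_le_iff₀ (mul_pos hT0 hM)]
  calc |(F - G) * M - G * (T - M)| ≤ 2 * δ * M := h2
    _ = 4 / M * δ * (M / 2 * M) := by field_simp; ring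
    _ ≤ 4 / M * δ * (T * M) := by gcongr

lemma cwCondProb_eq_sum_relWeight {p N : ℕ} (hN : 0 < N) (β h : ℝ) {m : ℝ}
    (hm : m ∈ Set.Ioo (-1 : ℝ) 1) {Δ : ℝ} (hΔ : Δ ≠ 0) (P : ℝ → Prop) [DecidablePred P]
    (A : Set ℝ) [DecidablePred (· ∈ A)] :
    cwCondProb p N β h {σ | P (mag σ)} {σ | mag σ / N ∈ A} =
      (Δ * ∑ k ∈ (Finset.range (N + 1)).filter (fun k : ℕ => P (2 * k - N)),
        if meanMag N k ∈ A then relWeight p β h m N k else 0) /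
      (Δ * ∑ k ∈ Finset.range (N + 1),
        if meanMag N k ∈ A then relWeight p β h m N k else 0) := by
  have hw := (peakWeight_pos (p := p) (β := β) (h := h) hm hN).ne'
  have hsum : ∀ s : Finset ℕ, (∑ k ∈ s, if meanMag N k ∈ A then relWeight p β h m N k else 0) =
      (∑ k ∈ s, if meanMag N k ∈ A then (N.choose k : ℝ) * exp (N * energy p β h (meanMag N k))
        else 0) / peakWeight p β h m N := fun s => by
    rw [Finset.sum_div]
    refine Finset.sum_congr rfl fun k _ => ?_
    rw [ite_div, zero_div, relWeight]
  rw [hsum, hsum, mul_div_mul_left _ _ hΔ, div_div_div_cancel_right₀ hw]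
  exact cwCondProb_eq_sum_choose hN β h P (fun v => v / N ∈ A)

/-- **Berry–Esseen bound at `p`-critical points.** -/
theorem berry_esseen_critical
    (p : ℕ) (hp : 3 ≤ p) (β h m : ℝ) (hβ : 0 < β) (hh : 0 < h)
    (hcrit : pCritical p β h) (hmax : isMaximizer p β h m)
    (hH'' : iteratedDeriv 2 (Hfun p β h) m < 0)
    (A : Set ℝ) (hAopen : IsOpen A) (hmA : m ∈ A)
    (hAuniq : ∀ x ∈ closure A, isMaximizer p β h x → x = m) :
    ∃ C : ℝ, 0 < C ∧ ∃ N₀ : ℕ,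
      ∀ N : ℕ, N₀ ≤ N → ∀ x : ℝ,
        |cwCondProb p N β h
            {σ | (mag σ - N * m) /
                Real.sqrt (-(N : ℝ) / iteratedDeriv 2 (Hfun p β h) m) ≤ x}
            {σ | mag σ / N ∈ A} -
          stdNormCDF x|
          ≤ C * (N : ℝ) ^ (-(1:ℝ)/2) := by
  classical
  set l : ℝ := -iteratedDeriv 2 (Hfun p β h) m with hl
  have hl0 : 0 < l := neg_pos.2 hH''
  have hm := hmax.1
  obtain ⟨c, hc, K, hK, hweight⟩ :=
    exists_abs_relWeight_sub_gaussian_le hβ hh hmax hH'' hAopen hmA hAuniq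
  have hmin : 0 < min (1 + m) (1 - m) := lt_min (by linarith [hm.1]) (by linarith [hm.2])
  obtain ⟨C, hC, hlattice⟩ := exists_abs_lattice_sum_sub_gaussPrimitive_le
    (c := c / l) (K := K / (2 * √l)) (a := 2 * l * min (1 + m) (1 - m))
    (by positivity) (by positivity) (by positivity)
  have hM : 0 < √(2 * π) := by positivity
  have htend : Tendsto (fun N : ℕ => 2 * √l / √(N : ℝ)) atTop (𝓝 0) :=
    tendsto_const_nhds.div_atTop (tendsto_sqrt_atTop.comp tendsto_natCast_atTop_atTop)
  obtain ⟨N₀, hN₀⟩ := eventually_atTop.1 (((htend.eventually_le_const (u := 2) (by norm_num)).and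
    (htend.eventually_le_const (u := √(2 * π) / 2 / C) (by positivity))).and
    (eventually_gt_atTop 0))
  refine ⟨4 / √(2 * π) * (C * (2 * √l)), by positivity, N₀, fun N hN x => ?_⟩
  obtain ⟨⟨hΔ2, hΔC⟩, hNpos⟩ := hN₀ N hN
  have hN' : (0 : ℝ) < N := by exact_mod_cast hNpos
  set Δ : ℝ := 2 * √l / √(N : ℝ) with hΔ
  have hΔ0 : 0 < Δ := by positivity
  have hsN : √(N : ℝ) ^ 2 = N := sq_sqrt hN'.le
  have hsl : √l ^ 2 = l := sq_sqrt hl0.le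
  have hs : √(-(N : ℝ) / iteratedDeriv 2 (Hfun p β h) m) = √(N : ℝ) / √l := by
    rw [← sqrt_div hN'.le, hl, div_neg, neg_div]
  have hsΔ : √(N : ℝ) / √l = 2 / Δ := by rw [hΔ]; field_simp
  have hNΔ : N * Δ ^ 2 = 4 * l := by
    rw [hΔ, div_pow, mul_pow, hsN, hsl]; field_simp; norm_num
  set t₀ : ℝ := -(2 * l * (1 + m) / Δ) with ht₀
  have htk : ∀ k : ℕ, t₀ + k * Δ = (2 * k - N - N * m) / (2 / Δ) := fun k => by
    rw [ht₀]
    field_simp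
    linear_combination (1 + m) * hNΔ
  have hsq : ∀ k : ℕ, N * (meanMag N k - m) ^ 2 = (t₀ + k * Δ) ^ 2 / l := fun k => by
    have hlN : l = N * Δ ^ 2 / 4 := by linarith
    rw [htk, meanMag, hlN]
    field_simp
    ring
  have hleft : t₀ ≤ -(2 * l * min (1 + m) (1 - m) / Δ) := by
    rw [ht₀]
    gcongr
    exact min_le_left _ _
  have hright : 2 * l * min (1 + m) (1 - m) / Δ ≤ t₀ + N * Δ := by
    rw [htk, div_le_iff₀ hΔ0]
    have : (2 * (N : ℝ) - N - N * m) / (2 / Δ) * Δ = 2 * l * (1 - m) := by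
      field_simp
      linear_combination (1 - m) * hNΔ
    rw [this]
    gcongr
    exact min_le_right _ _
  obtain ⟨hT, hF⟩ := hlattice Δ t₀
    (fun k => if meanMag N k ∈ A then relWeight p β h m N k else 0) N hΔ0 hΔ2 hleft hright
    fun k hk => by
      convert hweight N k hNpos (by omega) using 2
      · congr 2
        rw [mul_left_comm, hsq, ← neg_neg (iteratedDeriv 2 (Hfun p β h) m), ← hl]
        field_simp
      · rw [hΔ]; field_simp
      · rw [hsq]; congr 1; ring
  rw [hs, hsΔ, stdNormCDF_eq, cwCondProb_eq_sum_relWeight hNpos β h hm hΔ0.ne'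
    (fun v => (v - N * m) / (2 / Δ) ≤ x) A]
  have hF' := hF x
  simp only [htk] at hF'
  refine (abs_div_sub_div_le hM (gaussPrimitive_nonneg x) (gaussPrimitive_le x) hF' hT
    ?_).trans_eq ?_
  · rwa [le_div_iff₀' hC] at hΔC
  · rw [neg_div, rpow_neg hN'.le, ← sqrt_eq_rpow, hΔ]
    field_simp
end
end

section
/- Let p ≥ 3 and (β,h) be a p-special point with unique global maximizer m_* of H = H_{β,h,p}. Then there exists a constant C > 0 such that for all N ≥ 1, sup_{x > 0} | P( (S_N − N m_*)/N^{3/4} ≤ x ) − F(x) | ≤ C·N^{−1/4}, where F is the distribution on ℝ with Lebesgue density dF(x) = (2/Γ(1/4)) (−H^{(4)}(m_*)/24)^{1/4} exp( H^{(4)}(m_*) x^4 / 24 ) dx. -/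
open Real MeasureTheory Filter
open scoped BigOperators Topology

noncomputable section

/-! ### Stirling bounds for binomial coefficients -/

/-- The error term in Stirling's formula for `log n!`. -/
def stirlingErr (n : ℕ) : ℝ :=
  Real.log (n.factorial) - (n * Real.log n - n + Real.log n / 2 + Real.log (2 * π) / 2)

lemma stirlingErr_eq {n : ℕ} (hn : n ≠ 0) :
    stirlingErr n = Real.log (Stirling.stirlingSeq n) - Real.log (√π) := by
  have h0 : (n : ℝ) ≠ 0 := by exact_mod_cast hn
  rw [Stirling.log_stirlingSeq_formula, Real.log_sqrt (by positivity), stirlingErr,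
    Real.log_mul (by norm_num) h0, Real.log_div h0 (by positivity), Real.log_exp,
    Real.log_mul (by norm_num) (by positivity)]
  ring

lemma stirlingErr_nonneg {n : ℕ} (hn : n ≠ 0) : 0 ≤ stirlingErr n := by
  rw [stirlingErr_eq hn]
  exact sub_nonneg.2 (Real.log_le_log (by positivity) (Stirling.sqrt_pi_le_stirlingSeq hn))

lemma stirlingErr_le {n : ℕ} (hn : n ≠ 0) : stirlingErr n ≤ 1 / n := by
  have hstep : ∀ k : ℕ, Real.log (Stirling.stirlingSeq n) - 1 / n
      ≤ Real.log (Stirling.stirlingSeq (n + k)) - 1 / ((n + k : ℕ) : ℝ) := by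
    intro k
    induction k with
    | zero => simp
    | succ k ih =>
      refine ih.trans ?_
      have h1 := Stirling.log_stirlingSeq_sdiff_le (n + k)
      have hpos : (0 : ℝ) < ((n + k : ℕ) : ℝ) := by exact_mod_cast by omega
      rw [← add_assoc]
      set q : ℝ := ((n + k : ℕ) : ℝ) with hq
      have hq1 : ((n + k + 1 : ℕ) : ℝ) = q + 1 := by push_cast [hq]; ring
      rw [hq1]
      have h2 : 1 / q - 1 / (q + 1) = 1 / (q * (q + 1)) := by field_simp; ring
      have h3 : 1 / (12 * q * (q + 1)) ≤ 1 / (q * (q + 1)) := by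
        apply one_div_le_one_div_of_le (by positivity)
        nlinarith [mul_pos hpos (by linarith : 0 < q + 1)]
      linarith
  have hlim : Tendsto (fun k : ℕ => Real.log (Stirling.stirlingSeq (n + k))) atTop
      (𝓝 (Real.log (√π))) := by
    have h1 : Tendsto (fun k : ℕ => Stirling.stirlingSeq (n + k)) atTop (𝓝 (√π)) := by
      have := (tendsto_add_atTop_iff_nat n).2 Stirling.tendsto_stirlingSeq_sqrt_pi
      simpa [add_comm] using this
    exact h1.log (by positivity)
  have := ge_of_tendsto' hlim (fun k => (hstep k).trans (sub_le_self _ (by positivity)))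
  rw [stirlingErr_eq hn]
  linarith

/-- Stirling's formula for the binomial coefficients, with explicit error terms. -/
lemma log_choose_eq {N j : ℕ} {x : ℝ} (hj : j ≠ 0) (hjN : j < N)
    (hx : x = (2 * j - N) / N) :
    Real.log (N.choose j) = N * Real.log 2 - N * binEnt x
      + (Real.log 2 - Real.log π - Real.log N) / 2 - Real.log (1 - x ^ 2) / 2
      + stirlingErr N - stirlingErr j - stirlingErr (N - j) := by
  have hN : (0 : ℝ) < N := by exact_mod_cast by omega
  have hj0 : (0 : ℝ) < j := by exact_mod_cast by omega
  have hj1 : (0 : ℝ) < N - j := by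
    have : (j : ℝ) < N := by exact_mod_cast hjN
    linarith
  have e1 : 1 + x = 2 * j / N := by rw [hx]; field_simp; ring
  have e2 : 1 - x = 2 * (N - j) / N := by rw [hx]; field_simp; ring
  have e3 : 1 - x ^ 2 = (1 + x) * (1 - x) := by ring
  have l1 : Real.log (1 + x) = Real.log 2 + Real.log j - Real.log N := by
    rw [e1, Real.log_div (by positivity) (by positivity), Real.log_mul (by norm_num) (by positivity)]
  have l2 : Real.log (1 - x) = Real.log 2 + Real.log (N - j) - Real.log N := by
    rw [e2, Real.log_div (by positivity) (by positivity), Real.log_mul (by norm_num) (by positivity)]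
  have l3 : Real.log (1 - x ^ 2) = Real.log (1 + x) + Real.log (1 - x) := by
    rw [e3, Real.log_mul]
    · rw [e1]; positivity
    · rw [e2]; positivity
  have c : Real.log (N.choose j) = Real.log N.factorial - Real.log j.factorial
      - Real.log (N - j).factorial := by
    rw [Nat.cast_choose ℝ hjN.le, Real.log_div (by positivity) (by positivity),
      Real.log_mul (by positivity) (by positivity)]
    ring
  rw [c, binEnt, l3, l1, l2, e1, e2]
  unfold stirlingErr
  rw [Nat.cast_sub hjN.le, Real.log_mul (by norm_num : (2 : ℝ) ≠ 0) Real.pi_ne_zero]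
  field_simp
  ring

/-- The entropy bound for binomial coefficients. -/
lemma choose_le_exp_binEnt_s5 {N j : ℕ} {x : ℝ} (hN0 : N ≠ 0) (hjN : j ≤ N)
    (hx : x = (2 * j - N) / N) :
    (N.choose j : ℝ) ≤ 2 ^ N * Real.exp (-(N * binEnt x)) := by
  have hN : (0 : ℝ) < N := Nat.cast_pos.2 (Nat.pos_of_ne_zero hN0)
  have hj1 : (0 : ℝ) ≤ N - j := by
    have : (j : ℝ) ≤ N := by exact_mod_cast hjN
    linarith
  have e1 : 1 + x = 2 * j / N := by rw [hx]; field_simp; ring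
  have e2 : 1 - x = 2 * (N - j) / N := by rw [hx]; field_simp; ring
  have hpow : ∀ (y : ℝ) (k : ℕ), 0 ≤ y → y = 2 * k / N →
      y ^ k = Real.exp (N * (y * Real.log y) / 2) := by
    intro y k hy0 hy
    rcases Nat.eq_zero_or_pos k with rfl | hk
    · simp [hy]
    · have hk' : (0 : ℝ) < k := by exact_mod_cast hk
      have : 0 < y := by rw [hy]; positivity
      have h2 : N * (y * Real.log y) / 2 = k * Real.log y := by
        have : N * y = 2 * k := by rw [hy]; field_simp
        linear_combination Real.log y / 2 * this
      rw [h2, Real.exp_nat_mul, Real.exp_log this]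
  have p1 := hpow (1 + x) j (by rw [e1]; positivity) e1
  have p2 := hpow (1 - x) (N - j) (by rw [e2]; positivity) (by rw [e2, Nat.cast_sub hjN])
  have key : (1 + x) ^ j * (1 - x) ^ (N - j) * (N.choose j : ℝ) ≤ ((1 + x) + (1 - x)) ^ N := by
    rw [add_pow (1 + x) (1 - x) N]
    refine Finset.single_le_sum (f := fun i => (1 + x) ^ i * (1 - x) ^ (N - i) * (N.choose i : ℝ))
      (fun i _ => ?_) (Finset.mem_range.2 (Nat.lt_succ_of_le hjN))
    have : 0 ≤ 1 + x := by rw [e1]; positivity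
    have : 0 ≤ 1 - x := by rw [e2]; positivity
    positivity
  rw [p1, p2, ← Real.exp_add] at key
  have e : N * ((1 + x) * Real.log (1 + x)) / 2 + N * ((1 - x) * Real.log (1 - x)) / 2
      = N * binEnt x := by unfold binEnt; ring
  rw [e, show (1 + x) + (1 - x) = 2 by ring] at key
  rw [Real.exp_neg, ← div_eq_mul_inv, le_div_iff₀ (Real.exp_pos _)]
  linarith

/-! ### Reduction to a sum over the number of positive spins -/

/-- The Gibbs weight of the event that exactly `j` of the `N` spins are positive. -/
def levelWeight (p N : ℕ) (β h : ℝ) (j : ℕ) : ℝ :=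
  N.choose j * Real.exp (N * (β * ((2 * j - N) / N) ^ p + h * ((2 * j - N) / N)))

lemma mag_eq {N : ℕ} (σ : Fin N → Bool) :
    mag σ = 2 * (Finset.univ.filter fun i => σ i = true).card - N := by
  have : ∀ i, spin (σ i) = 2 * (if σ i = true then 1 else 0) - 1 := by
    intro i; unfold spin; split_ifs <;> norm_num
  simp only [mag, this, Finset.sum_sub_distrib, ← Finset.mul_sum, Finset.sum_boole]
  simp

lemma cwHamiltonian_eq {p N : ℕ} (hN : N ≠ 0) (β h : ℝ) (σ : Fin N → Bool) :
    cwHamiltonian p N β h σ = N * (β * (mag σ / N) ^ p + h * (mag σ / N)) := by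
  have hN' : (N : ℝ) ≠ 0 := by exact_mod_cast hN
  have e : (∑ i : Fin p → Fin N, ∏ j, spin (σ (i j))) = mag σ ^ p := by
    rw [mag, Finset.sum_pow', Fintype.piFinset_univ]
  rw [cwHamiltonian, e, zpow_sub₀ hN', zpow_one, zpow_natCast, div_pow]
  field_simp

lemma sum_config_eq_sum_range (N : ℕ) (f : ℝ → ℝ) :
    ∑ σ : Fin N → Bool, f (mag σ) = ∑ j ∈ Finset.range (N + 1), N.choose j * f (2 * j - N) := by
  have h1 : ∑ σ : Fin N → Bool, f (mag σ)
      = ∑ s ∈ (Finset.univ : Finset (Fin N)).powerset, f (2 * (s.card : ℕ) - N) := by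
    rw [Finset.powerset_univ]
    refine Finset.sum_bij' (fun σ _ => Finset.univ.filter fun i => σ i = true)
      (fun s _ => fun i => decide (i ∈ s)) ?_ ?_ ?_ ?_ ?_
    · simp
    · simp
    · intro σ _; ext i; simp
    · intro s _; ext i; simp
    · intro σ _; rw [mag_eq]
  rw [h1, Finset.sum_powerset_apply_card (fun k : ℕ => f (2 * k - N))]
  simp

lemma cwProb_eq {p N : ℕ} (hN : N ≠ 0) (β h : ℝ) (P : ℝ → Prop) [DecidablePred P] :
    cwProb p N β h {σ | P (mag σ)}
      = (∑ j ∈ (Finset.range (N + 1)).filter (fun j : ℕ => P (2 * j - N)), levelWeight p N β h j)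
        / ∑ j ∈ Finset.range (N + 1), levelWeight p N β h j := by
  have e1 := sum_config_eq_sum_range N
    (fun s => if P s then Real.exp (N * (β * (s / N) ^ p + h * (s / N))) else 0)
  have e2 := sum_config_eq_sum_range N
    (fun s => Real.exp (N * (β * (s / N) ^ p + h * (s / N))))
  unfold cwProb cwWeight
  simp only [Set.indicator_apply, Set.mem_ofPred_eq, cwHamiltonian_eq hN]
  congr 1
  · rw [Finset.sum_filter]
    convert e1 using 2 with σ _ j _
    simp only [levelWeight, mul_ite, mul_zero]

/-! ### The quartic exponential density -/

/-- The unnormalized distribution function of the density `exp (-a t⁴)`. -/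
def quarticCDF (a x : ℝ) : ℝ := ∫ t in Set.Iic x, Real.exp (-a * t ^ 4)

lemma exists_mul_exp_neg_quartic_le {b : ℝ} (hb : 0 < b) :
    ∃ K : ℝ, 0 < K ∧ ∀ u : ℝ,
      (1 + |u| + |u| ^ 3 + |u| ^ 5) * Real.exp (-b * u ^ 4) ≤ K * (1 + u ^ 2)⁻¹ := by
  have hm : 0 < min 1 (b ^ 2 / 2) := by positivity
  refine ⟨8 / min 1 (b ^ 2 / 2), by positivity, fun u => ?_⟩
  have habs : ∀ v : ℝ, 0 ≤ v → (1 + v + v ^ 3 + v ^ 5) * (1 + v ^ 2) ≤ 8 * (1 + v ^ 8) := by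
    intro v hv
    have hk : ∀ k : ℕ, k ≤ 8 → v ^ k ≤ 1 + v ^ 8 := by
      intro k hk
      rcases le_total v 1 with h | h
      · have := pow_le_one₀ (n := k) hv h
        have : 0 ≤ v ^ 8 := by positivity
        linarith
      · have := pow_le_pow_right₀ h hk
        linarith
    have h0 := hk 1 (by norm_num)
    have h2 := hk 2 (by norm_num)
    have h3 := hk 3 (by norm_num)
    have h5 := hk 5 (by norm_num)
    have h7 := hk 7 (by norm_num)
    have h8 : 0 ≤ v ^ 8 := by positivity
    have : (1 + v + v ^ 3 + v ^ 5) * (1 + v ^ 2)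
      = 1 + v ^ 1 + v ^ 2 + 2 * v ^ 3 + 2 * v ^ 5 + v ^ 7 := by ring
    rw [this]
    linarith
  have h1 := habs |u| (abs_nonneg u)
  rw [sq_abs] at h1
  have e8 : |u| ^ 8 = u ^ 8 := by rw [show 8 = 2 * 4 by norm_num, pow_mul, sq_abs, ← pow_mul]
  rw [e8] at h1
  have h2 : min 1 (b ^ 2 / 2) * (1 + u ^ 8) ≤ Real.exp (b * u ^ 4) := by
    have h3 := Real.quadratic_le_exp_of_nonneg (x := b * u ^ 4) (by positivity)
    have h4 : min 1 (b ^ 2 / 2) * u ^ 8 ≤ (b ^ 2 / 2) * u ^ 8 :=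
      mul_le_mul_of_nonneg_right (min_le_right _ _) (by positivity)
    have h5 : min 1 (b ^ 2 / 2) ≤ 1 := min_le_left _ _
    have h6 : 0 ≤ b * u ^ 4 := by positivity
    nlinarith
  rw [neg_mul, Real.exp_neg, ← div_eq_mul_inv, ← div_eq_mul_inv, div_le_div_iff₀ (Real.exp_pos _)
    (by positivity)]
  calc _ ≤ 8 * (1 + u ^ 8) := h1
    _ = 8 / min 1 (b ^ 2 / 2) * (min 1 (b ^ 2 / 2) * (1 + u ^ 8)) := by field_simp
    _ ≤ _ := by gcongr

lemma exp_neg_quartic_le {b : ℝ} (hb : 0 < b) :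
    ∃ K : ℝ, 0 < K ∧ ∀ u : ℝ, Real.exp (-b * u ^ 4) ≤ K * (1 + u ^ 2)⁻¹ := by
  obtain ⟨K, hK, h⟩ := exists_mul_exp_neg_quartic_le hb
  refine ⟨K, hK, fun u => le_trans ?_ (h u)⟩
  refine le_mul_of_one_le_left (Real.exp_pos _).le ?_
  have : 0 ≤ |u| := abs_nonneg u
  have : 0 ≤ |u| ^ 3 := by positivity
  have : 0 ≤ |u| ^ 5 := by positivity
  linarith

lemma integrable_exp_neg_quartic {a : ℝ} (ha : 0 < a) :
    Integrable (fun t : ℝ => Real.exp (-a * t ^ 4)) := by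
  obtain ⟨K, hK, h⟩ := exp_neg_quartic_le ha
  refine Integrable.mono' (integrable_inv_one_add_sq.const_mul K) (by fun_prop)
    (Eventually.of_forall fun t => ?_)
  rw [Real.norm_eq_abs, abs_of_pos (Real.exp_pos _)]
  exact h t

lemma integral_exp_neg_quartic {a : ℝ} (ha : 0 < a) :
    ∫ t : ℝ, Real.exp (-a * t ^ 4) = Real.Gamma (1 / 4) / 2 * a ^ (-(1 : ℝ) / 4) := by
  have h1 := integral_exp_neg_mul_rpow (p := 4) (b := a) (by norm_num) ha
  have h2 : ∫ t in Set.Ioi (0 : ℝ), Real.exp (-a * t ^ 4)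
      = a ^ (-1 / (4 : ℝ)) * Real.Gamma (1 / 4 + 1) := by
    rw [← h1]
    norm_cast
  have h3 := integral_comp_abs (f := fun t : ℝ => Real.exp (-a * t ^ 4))
  have h4 : ∀ t : ℝ, |t| ^ 4 = t ^ 4 := fun t => by
    rw [show 4 = 2 * 2 by norm_num, pow_mul, sq_abs, ← pow_mul]
  simp only [h4] at h3
  rw [h3, h2, Real.Gamma_add_one (by norm_num)]
  ring

lemma specialCDF_eq {c : ℝ} (hc : c < 0) (x : ℝ) :
    specialCDF c x = quarticCDF (-c / 24) x / ∫ t : ℝ, Real.exp (-(-c / 24) * t ^ 4) := by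
  have ha : 0 < -c / 24 := by linarith
  have hΓ : 0 < Real.Gamma (1 / 4) := Real.Gamma_pos_of_pos (by norm_num)
  rw [integral_exp_neg_quartic ha, specialCDF, quarticCDF, integral_const_mul,
    neg_div 4 (1 : ℝ), Real.rpow_neg ha.le]
  have : ∀ t : ℝ, c * t ^ 4 / 24 = -(-c / 24) * t ^ 4 := fun t => by ring
  simp only [this]
  have : 0 < (-c / 24) ^ ((1 : ℝ) / 4) := by positivity
  field_simp

lemma quarticCDF_sub {a : ℝ} (ha : 0 < a) (x y : ℝ) :
    quarticCDF a y - quarticCDF a x = ∫ t in x..y, Real.exp (-a * t ^ 4) :=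
  intervalIntegral.integral_Iic_sub_Iic (integrable_exp_neg_quartic ha).integrableOn
    (integrable_exp_neg_quartic ha).integrableOn

lemma quarticCDF_sub_nonneg {a : ℝ} (ha : 0 < a) {x y : ℝ} (hxy : x ≤ y) :
    0 ≤ quarticCDF a y - quarticCDF a x := by
  rw [quarticCDF_sub ha]
  exact intervalIntegral.integral_nonneg hxy fun _ _ => (Real.exp_pos _).le

lemma quarticCDF_sub_le {a : ℝ} (ha : 0 < a) {x y : ℝ} (hxy : x ≤ y) :
    quarticCDF a y - quarticCDF a x ≤ y - x := by
  rw [quarticCDF_sub ha]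
  have := intervalIntegral.norm_integral_le_of_norm_le_const (a := x) (b := y) (C := 1)
    (f := fun t : ℝ => Real.exp (-a * t ^ 4)) (fun t _ => by
      rw [Real.norm_eq_abs, abs_of_pos (Real.exp_pos _), Real.exp_le_one_iff, neg_mul,
        neg_nonpos]
      positivity)
  rw [one_mul, abs_of_nonneg (sub_nonneg.2 hxy)] at this
  exact (le_abs_self _).trans this

lemma quarticCDF_nonneg (a x : ℝ) : 0 ≤ quarticCDF a x :=
  integral_nonneg fun _ => (Real.exp_pos _).le

lemma quarticCDF_tail {a : ℝ} (ha : 0 < a) :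
    ∃ K : ℝ, 0 < K ∧ ∀ L : ℝ, 0 < L → quarticCDF a (-L) ≤ K / L ∧
      0 ≤ (∫ t : ℝ, Real.exp (-a * t ^ 4)) - quarticCDF a L ∧
      (∫ t : ℝ, Real.exp (-a * t ^ 4)) - quarticCDF a L ≤ K / L := by
  obtain ⟨K, hK, h⟩ := exp_neg_quartic_le ha
  have hi := integrable_exp_neg_quartic ha
  have hj := integrable_inv_one_add_sq.const_mul K
  have harc : ∀ L : ℝ, 0 < L → π / 2 - Real.arctan L ≤ 1 / L := by
    intro L hL
    rw [← Real.arctan_inv_of_pos hL, one_div]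
    have h0 : 0 < L⁻¹ := by positivity
    have h1 := Real.lt_tan (Real.arctan_pos.2 h0) (Real.arctan_lt_pi_div_two _)
    rw [Real.tan_arctan] at h1
    exact h1.le
  refine ⟨K, hK, fun L hL => ?_⟩
  have hfin : K * (π / 2 - Real.arctan L) ≤ K / L := by
    rw [div_eq_mul_one_div K L]
    exact mul_le_mul_of_nonneg_left (harc L hL) hK.le
  have hsplit : (∫ t : ℝ, Real.exp (-a * t ^ 4)) - quarticCDF a L
      = ∫ t in Set.Ioi L, Real.exp (-a * t ^ 4) := by
    rw [quarticCDF, ← intervalIntegral.integral_Iic_add_Ioi hi.integrableOn hi.integrableOn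
      (b := L)]
    ring
  refine ⟨?_, ?_, ?_⟩
  · refine le_trans ?_ hfin
    have e : K * (π / 2 - Real.arctan L) = ∫ t in Set.Iic (-L), K * (1 + t ^ 2)⁻¹ := by
      rw [integral_const_mul, integral_Iic_inv_one_add_sq, Real.arctan_neg]
      ring
    rw [e]
    exact integral_mono hi.integrableOn hj.integrableOn h
  · rw [hsplit]
    exact integral_nonneg fun _ => (Real.exp_pos _).le
  · refine le_trans ?_ hfin
    rw [hsplit, ← integral_Ioi_inv_one_add_sq, ← integral_const_mul]
    exact integral_mono hi.integrableOn hj.integrableOn h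

/-- Nearby points have comparable values of `1 + t²`. -/
lemma inv_one_add_sq_le {v t : ℝ} (h : |t - v| ≤ 2) : (1 + t ^ 2)⁻¹ ≤ 9 * (1 + v ^ 2)⁻¹ := by
  rw [← div_eq_mul_inv, inv_eq_one_div, div_le_div_iff₀ (by positivity) (by positivity)]
  have h2 : (t - v) ^ 2 ≤ 2 ^ 2 := sq_le_sq' (by linarith [(abs_le.1 h).1]) (abs_le.1 h).2
  nlinarith [sq_nonneg (2 * t - v)]

lemma quarticCDF_increment {a : ℝ} (ha : 0 < a) :
    ∃ K : ℝ, 0 < K ∧ ∀ v δ : ℝ, 0 < δ → δ ≤ 2 →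
      |quarticCDF a (v + δ) - quarticCDF a v - δ * Real.exp (-a * v ^ 4)|
        ≤ K * δ * (δ * (1 + v ^ 2)⁻¹) := by
  obtain ⟨K, hK, h⟩ := exists_mul_exp_neg_quartic_le ha
  refine ⟨4 * a * K * 9, by positivity, fun v δ hδ hδ2 => ?_⟩
  have hderiv : ∀ t : ℝ, HasDerivAt (fun t : ℝ => Real.exp (-a * t ^ 4))
      (Real.exp (-a * t ^ 4) * (-a * (4 * t ^ 3))) t := by
    intro t
    have := ((hasDerivAt_pow 4 t).const_mul (-a)).exp
    simpa using this
  have hbound : ∀ t ∈ Set.Icc v (v + δ),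
      ‖Real.exp (-a * t ^ 4) * (-a * (4 * t ^ 3))‖ ≤ 4 * a * K * 9 * (1 + v ^ 2)⁻¹ := by
    intro t ht
    have h1 : |t - v| ≤ 2 := by
      rw [abs_of_nonneg (by linarith [ht.1])]
      linarith [ht.2]
    have h2 := inv_one_add_sq_le h1
    have h3 : |t| ^ 3 * Real.exp (-a * t ^ 4) ≤ K * (1 + t ^ 2)⁻¹ := by
      refine le_trans ?_ (h t)
      gcongr
      have : 0 ≤ |t| := abs_nonneg t
      have : 0 ≤ |t| ^ 5 := by positivity
      linarith
    rw [norm_mul, Real.norm_eq_abs, Real.norm_eq_abs, abs_of_pos (Real.exp_pos _), abs_mul,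
      abs_neg, abs_of_pos ha, abs_mul, abs_pow]
    have h4 : |(4 : ℝ)| = 4 := by norm_num
    rw [h4]
    calc Real.exp (-a * t ^ 4) * (a * (4 * |t| ^ 3))
        = 4 * a * (|t| ^ 3 * Real.exp (-a * t ^ 4)) := by ring
      _ ≤ 4 * a * (K * (9 * (1 + v ^ 2)⁻¹)) := by
          have := h3.trans (mul_le_mul_of_nonneg_left h2 hK.le)
          gcongr
      _ = _ := by ring
  have hlip : ∀ t ∈ Set.Icc v (v + δ), |Real.exp (-a * t ^ 4) - Real.exp (-a * v ^ 4)|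
      ≤ 4 * a * K * 9 * (1 + v ^ 2)⁻¹ * δ := by
    intro t ht
    have := (convex_Icc v (v + δ)).norm_image_sub_le_of_norm_hasDerivWithin_le
      (fun s _ => (hderiv s).hasDerivWithinAt) hbound
      (Set.left_mem_Icc.2 (by linarith)) ht
    rw [Real.norm_eq_abs, Real.norm_eq_abs, abs_of_nonneg (by linarith [ht.1] : 0 ≤ t - v)] at this
    refine this.trans ?_
    gcongr
    linarith [ht.2]
  have hcont : Continuous fun t : ℝ => Real.exp (-a * t ^ 4) := by fun_prop
  have e : quarticCDF a (v + δ) - quarticCDF a v - δ * Real.exp (-a * v ^ 4)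
      = ∫ t in v..(v + δ), (Real.exp (-a * t ^ 4) - Real.exp (-a * v ^ 4)) := by
    rw [quarticCDF_sub ha, intervalIntegral.integral_sub (hcont.intervalIntegrable _ _)
      (by simp), intervalIntegral.integral_const]
    simp
  rw [e]
  have := intervalIntegral.norm_integral_le_of_norm_le_const (a := v) (b := v + δ)
    (C := 4 * a * K * 9 * (1 + v ^ 2)⁻¹ * δ)
    (f := fun t => Real.exp (-a * t ^ 4) - Real.exp (-a * v ^ 4)) (fun t ht => by
      rw [Set.uIoc_of_le (by linarith)] at ht
      exact hlip t ⟨ht.1.le, ht.2⟩)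
  rw [Real.norm_eq_abs, add_sub_cancel_left, abs_of_pos hδ] at this
  refine this.trans (le_of_eq (by ring))

lemma sum_inv_one_add_sq_le {u : ℕ → ℝ} {δ : ℝ} (hδ : 0 < δ) (hδ2 : δ ≤ 2)
    (hu : ∀ j, u (j + 1) = u j + δ) (n : ℕ) :
    ∑ j ∈ Finset.range n, δ * (1 + u j ^ 2)⁻¹ ≤ 9 * π := by
  have hstep : ∀ v : ℝ, δ * (1 + v ^ 2)⁻¹ ≤ 9 * (Real.arctan (v + δ) - Real.arctan v) := by
    intro v
    obtain ⟨ξ, hξ, h⟩ := exists_hasDerivAt_eq_slope Real.arctan (fun t => (1 + t ^ 2)⁻¹)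
      (by linarith : v < v + δ) Real.continuous_arctan.continuousOn
      (fun t _ => Real.hasDerivAt_arctan' t)
    rw [add_sub_cancel_left, eq_div_iff hδ.ne'] at h
    have h1 : (1 + v ^ 2)⁻¹ ≤ 9 * (1 + ξ ^ 2)⁻¹ := by
      apply inv_one_add_sq_le
      rw [abs_sub_comm, abs_of_nonneg (by linarith [hξ.1])]
      linarith [hξ.2]
    rw [← h]
    nlinarith
  calc ∑ j ∈ Finset.range n, δ * (1 + u j ^ 2)⁻¹
      ≤ ∑ j ∈ Finset.range n, 9 * (Real.arctan (u (j + 1)) - Real.arctan (u j)) :=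
        Finset.sum_le_sum fun j _ => by rw [hu]; exact hstep _
    _ = 9 * (Real.arctan (u n) - Real.arctan (u 0)) := by
        rw [← Finset.mul_sum, Finset.sum_range_sub (fun j => Real.arctan (u j))]
    _ ≤ 9 * π := by
        have h1 := Real.arctan_lt_pi_div_two (u n)
        have h2 := Real.neg_pi_div_two_lt_arctan (u 0)
        linarith

/-! ### From pointwise to Kolmogorov bounds -/

lemma abs_div_sub_div_le_s5 {T T' G G' : ℝ} (hT : 0 ≤ T) (hTT : T ≤ T') (hT' : 0 < T') (hG' : 0 < G') :
    |T / T' - G / G'| ≤ (|T - G| + |T' - G'|) / G' := by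
  have e : T / T' - G / G' = ((T - G) - T / T' * (T' - G')) / G' := by
    field_simp
    ring
  rw [e, abs_div, abs_of_pos hG']
  gcongr
  refine (abs_sub _ _).trans ?_
  have : |T / T' * (T' - G')| ≤ |T' - G'| := by
    rw [abs_mul, abs_of_nonneg (div_nonneg hT hT'.le)]
    exact mul_le_of_le_one_left (abs_nonneg _) ((div_le_one hT').2 hTT)
  linarith

lemma filter_lattice_le_eq_range {N : ℕ} {u : ℕ → ℝ} (hu : Monotone u) {x : ℝ} (h0 : u 0 ≤ x) :
    ∃ J ≤ N, (Finset.range (N + 1)).filter (fun j => u j ≤ x) = Finset.range (J + 1) ∧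
      u J ≤ x ∧ (J = N ∨ x < u (J + 1)) := by
  classical
  set s := (Finset.range (N + 1)).filter (fun j => u j ≤ x) with hs
  have hne : s.Nonempty := ⟨0, by simp [hs, h0]⟩
  have hmem := Finset.mem_filter.1 (s.max'_mem hne)
  rw [Finset.mem_range] at hmem
  refine ⟨s.max' hne, by omega, ?_, hmem.2, ?_⟩
  · ext j
    rw [Finset.mem_range, Nat.lt_succ_iff]
    refine ⟨fun hj => s.le_max' j hj, fun hj => ?_⟩
    exact Finset.mem_filter.2 ⟨Finset.mem_range.2 (by omega), (hu hj).trans hmem.2⟩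
  · by_contra! hcon
    have : s.max' hne + 1 ∈ s :=
      Finset.mem_filter.2 ⟨Finset.mem_range.2 (by omega), hcon.2⟩
    have := s.le_max' _ this
    omega

/-- If lattice weights are pointwise close to the quartic density, then the corresponding
distribution functions are uniformly close. -/
lemma kolmogorov_bound_of_pointwise {a m K₀ : ℝ} (ha : 0 < a) (hm : m ∈ Set.Ioo (-1 : ℝ) 1)
    (hK₀ : 0 < K₀) :
    ∃ C : ℝ, 0 < C ∧ ∀ (N : ℕ) (r : ℝ) (u v : ℕ → ℝ), 1 ≤ r → r ^ 4 = N →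
      (∀ j : ℕ, u j = (2 * j - N - N * m) / r ^ 3) → (∀ j ≤ N, 0 < v j) →
      (∀ j ≤ N, |v j - Real.exp (-a * u j ^ 4)| ≤ K₀ / r * (1 + u j ^ 2)⁻¹) →
      ∀ x : ℝ, 0 < x →
      |(∑ j ∈ (Finset.range (N + 1)).filter (fun j => u j ≤ x), v j)
          / ∑ j ∈ Finset.range (N + 1), v j
        - quarticCDF a x / ∫ t : ℝ, Real.exp (-a * t ^ 4)| ≤ C / r := by
  obtain ⟨Ki, hKi, hinc⟩ := quarticCDF_increment ha
  obtain ⟨Kt, hKt, htail⟩ := quarticCDF_tail ha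
  have hGpos : 0 < ∫ t : ℝ, Real.exp (-a * t ^ 4) := by
    rw [integral_exp_neg_quartic ha]
    have := Real.Gamma_pos_of_pos (by norm_num : (0 : ℝ) < 1 / 4)
    positivity
  set G' := ∫ t : ℝ, Real.exp (-a * t ^ 4) with hG'
  have hm1 : 0 < 1 + m := by linarith [hm.1]
  have hm2 : 0 < 1 - m := by linarith [hm.2]
  set A := (K₀ + Ki * 2) * (9 * π) with hA
  set B := A + Kt / (1 + m) + Kt / (1 - m) + 2 with hB
  have hApos : 0 < A := by positivity
  have hBpos : 0 < B := by positivity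
  refine ⟨(B + B) / G', by positivity, fun N r u v hr hrN hu hv hclose x hx => ?_⟩
  have hr0 : 0 < r := by linarith
  set δ := 2 / r ^ 3 with hδ
  have hδ0 : 0 < δ := by positivity
  have hr3 : r ≤ r ^ 3 := le_self_pow₀ hr (by norm_num)
  have hδr : δ ≤ 2 / r := by rw [hδ]; gcongr
  have hδ2 : δ ≤ 2 := hδr.trans (by rw [div_le_iff₀ hr0]; linarith)
  have hstep : ∀ j, u (j + 1) = u j + δ := by
    intro j; rw [hu, hu, hδ]; push_cast; field_simp; ring
  have hmono : Monotone u := monotone_nat_of_le_succ fun j => by rw [hstep]; linarith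
  have hu0 : u 0 = -((1 + m) * r) := by
    rw [hu, ← hrN]; field_simp; push_cast; ring
  have huN : u N = (1 - m) * r := by
    rw [hu, ← hrN]; field_simp; ring
  have hpart : ∀ J ≤ N + 1, |δ * (∑ j ∈ Finset.range J, v j)
      - (quarticCDF a (u J) - quarticCDF a (u 0))| ≤ A / r := by
    intro J hJ
    rw [← Finset.sum_range_sub (fun j => quarticCDF a (u j)), Finset.mul_sum,
      ← Finset.sum_sub_distrib]
    calc _ ≤ ∑ j ∈ Finset.range J, |δ * v j - (quarticCDF a (u (j + 1)) - quarticCDF a (u j))| :=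
          Finset.abs_sum_le_sum_abs _ _
      _ ≤ ∑ j ∈ Finset.range J, (K₀ / r + Ki * δ) * (δ * (1 + u j ^ 2)⁻¹) := by
          refine Finset.sum_le_sum fun j hj => ?_
          have hjN : j ≤ N := by have := Finset.mem_range.1 hj; omega
          have h1 := hinc (u j) δ hδ0 hδ2
          have h2 : |δ * (v j - Real.exp (-a * u j ^ 4))| ≤ δ * (K₀ / r * (1 + u j ^ 2)⁻¹) := by
            rw [abs_mul, abs_of_pos hδ0]
            exact mul_le_mul_of_nonneg_left (hclose j hjN) hδ0.le
          rw [hstep]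
          calc _ = |δ * (v j - Real.exp (-a * u j ^ 4)) - (quarticCDF a (u j + δ)
                - quarticCDF a (u j) - δ * Real.exp (-a * u j ^ 4))| := by congr 1; ring
            _ ≤ _ := (abs_sub _ _).trans (add_le_add h2 h1)
            _ = _ := by ring
      _ ≤ (K₀ / r + Ki * δ) * (9 * π) := by
          rw [← Finset.mul_sum]
          gcongr
          exact sum_inv_one_add_sq_le hδ0 hδ2 hstep J
      _ ≤ (K₀ / r + Ki * (2 / r)) * (9 * π) := by gcongr
      _ = A / r := by rw [hA]; ring
  have hleft : quarticCDF a (u 0) ≤ Kt / (1 + m) / r := by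
    rw [hu0, div_div]
    exact (htail _ (by positivity)).1
  have hleft0 := quarticCDF_nonneg a (u 0)
  have hright : 0 ≤ G' - quarticCDF a (u N) ∧ G' - quarticCDF a (u N) ≤ Kt / (1 - m) / r := by
    rw [huN, div_div]
    exact (htail _ (by positivity)).2
  have hBr : B / r = A / r + Kt / (1 + m) / r + Kt / (1 - m) / r + 2 / r := by rw [hB]; ring
  have hpos1 : 0 ≤ Kt / (1 + m) / r := by positivity
  have hpos2 : 0 ≤ Kt / (1 - m) / r := by positivity
  have hle_total : ∀ y, 0 < y → quarticCDF a y ≤ G' := fun y hy => sub_nonneg.1 (htail y hy).2.1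
  have huNpos : 0 < u N := by rw [huN]; positivity
  have hN1 := hle_total (u (N + 1)) (by rw [hstep]; linarith)
  have hN2 := quarticCDF_sub_nonneg ha (hmono (Nat.le_succ N))
  have htotal : |δ * (∑ j ∈ Finset.range (N + 1), v j) - G'| ≤ B / r := by
    have h1 := abs_le.1 (hpart (N + 1) le_rfl)
    rw [hBr, abs_le]
    constructor <;> linarith [h1.1, h1.2, hright.2]
  obtain ⟨J, hJN, hJ, hJx, hJ'⟩ := filter_lattice_le_eq_range (N := N) hmono
    (show u 0 ≤ x by rw [hu0]; nlinarith)
  have hx1 : |δ * (∑ j ∈ Finset.range (J + 1), v j) - quarticCDF a x| ≤ B / r := by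
    have h1 := abs_le.1 (hpart (J + 1) (by omega))
    have h2 := quarticCDF_sub_nonneg ha hJx
    rw [hBr, abs_le]
    rcases hJ' with rfl | hlt
    · have h3 := hle_total x hx
      constructor <;> linarith [h1.1, h1.2, hright.2]
    · have h3 := quarticCDF_sub_nonneg ha hlt.le
      have h4 := quarticCDF_sub_le ha hlt.le
      have h5 : u (J + 1) - x ≤ δ := by rw [hstep]; linarith
      constructor <;> linarith [h1.1, h1.2]
  rw [hJ]
  have hsub : ∑ j ∈ Finset.range (J + 1), v j ≤ ∑ j ∈ Finset.range (N + 1), v j :=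
    Finset.sum_le_sum_of_subset_of_nonneg (Finset.range_mono (by omega)) fun j hj _ =>
      (hv j (Nat.lt_succ_iff.1 (Finset.mem_range.1 hj))).le
  have hnn : ∀ n ≤ N, 0 < ∑ j ∈ Finset.range (n + 1), v j := fun n hn =>
    Finset.sum_pos (fun j hj => hv j (by have := Finset.mem_range.1 hj; omega)) (by simp)
  have h1 := hnn J hJN
  have h2 := hnn N le_rfl
  rw [← mul_div_mul_left (∑ j ∈ Finset.range (J + 1), v j) _ hδ0.ne']
  refine (abs_div_sub_div_le_s5 (by positivity) (by gcongr) (by positivity) hGpos).trans ?_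
  calc _ ≤ (B / r + B / r) / G' := by gcongr
    _ = _ := by ring

/-! ### Local and global behaviour of `H` -/

lemma AnalyticAt.taylor_isBigO {f : ℝ → ℝ} {x : ℝ} (hf : AnalyticAt ℝ f x) (n : ℕ) :
    (fun y => f (x + y) - ∑ k ∈ Finset.range n, iteratedDeriv k f x / k.factorial * y ^ k)
      =O[𝓝 0] fun y => |y| ^ n := by
  have h := hf.hasFPowerSeriesAt.isBigO_sub_partialSum_pow n
  simpa [FormalMultilinearSeries.partialSum, FormalMultilinearSeries.ofScalars_apply_eq,
    smul_eq_mul, mul_comm] using h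

lemma iteratedDeriv_three_eq_zero_of_isLocalMax {f : ℝ → ℝ} {x : ℝ} (hmax : IsLocalMax f x)
    (hf : AnalyticAt ℝ f x) (h2 : iteratedDeriv 2 f x = 0) : iteratedDeriv 3 f x = 0 := by
  have h1 : iteratedDeriv 1 f x = 0 := by rw [iteratedDeriv_one]; exact hmax.deriv_eq_zero
  obtain ⟨C, hC, hO⟩ := (hf.taylor_isBigO 4).exists_pos
  have hO' := hO.bound
  have hmax' : ∀ᶠ y in 𝓝 (0 : ℝ), f (x + y) ≤ f x := by
    have : Tendsto (fun y : ℝ => x + y) (𝓝 0) (𝓝 x) := by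
      have h : Continuous fun y : ℝ => x + y := by fun_prop
      simpa using h.tendsto 0
    exact this.eventually hmax
  obtain ⟨ε, hε, hb⟩ := Metric.eventually_nhds_iff.1 (hO'.and hmax')
  set c := iteratedDeriv 3 f x / 6 with hc
  have key : ∀ t : ℝ, 0 < t → t < ε → |c| ≤ C * t := by
    intro t ht htε
    have hy : ∀ y : ℝ, |y| = t → c * y ^ 3 ≤ C * t ^ 4 := by
      intro y hy
      obtain ⟨b1, b2⟩ := hb (y := y) (by rw [Real.dist_eq, sub_zero, hy]; exact htε)
      simp only [Finset.sum_range_succ, Finset.sum_range_zero, h1, h2, Real.norm_eq_abs,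
        iteratedDeriv_zero, abs_pow, hy, abs_of_pos ht] at b1
      have := (abs_le.1 b1).1
      norm_num [Nat.factorial] at this
      rw [hc]
      linarith
    have p1 := hy t (abs_of_pos ht)
    have p2 := hy (-t) (by rw [abs_neg, abs_of_pos ht])
    have ht3 : 0 < t ^ 3 := by positivity
    rw [abs_le]
    constructor
    · refine le_of_mul_le_mul_right ?_ ht3
      linarith [show -(C * t) * t ^ 3 = -(C * t ^ 4) by ring,
        show c * (-t) ^ 3 = -(c * t ^ 3) by ring]
    · refine le_of_mul_le_mul_right ?_ ht3
      linarith [show C * t * t ^ 3 = C * t ^ 4 by ring]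
  have hc0 : c = 0 := by
    by_contra hne
    have hpos : 0 < |c| := abs_pos.2 hne
    have ht : 0 < min (ε / 2) (|c| / (2 * C)) := by positivity
    have := key _ ht ((min_le_left _ _).trans_lt (by linarith))
    have h3 : C * min (ε / 2) (|c| / (2 * C)) ≤ C * (|c| / (2 * C)) := by
      gcongr; exact min_le_right _ _
    have h4 : C * (|c| / (2 * C)) = |c| / 2 := by field_simp
    linarith
  rw [hc] at hc0
  linarith

lemma continuous_binEnt : Continuous binEnt := by
  unfold binEnt
  have h1 : Continuous fun x : ℝ => (1 + x) * Real.log (1 + x) :=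
    Real.continuous_mul_log.comp (by fun_prop : Continuous fun x : ℝ => 1 + x)
  have h2 : Continuous fun x : ℝ => (1 - x) * Real.log (1 - x) :=
    Real.continuous_mul_log.comp (by fun_prop : Continuous fun x : ℝ => 1 - x)
  exact continuous_const.mul (h1.add h2)

lemma hasDerivAt_Hfun (p : ℕ) (β h : ℝ) {x : ℝ} (hx : x ∈ Set.Ioo (-1 : ℝ) 1) :
    HasDerivAt (Hfun p β h)
      (β * (p * x ^ (p - 1)) + h - (Real.log (1 + x) - Real.log (1 - x)) / 2) x := by
  have h1 : 1 + x ≠ 0 := by linarith [hx.1]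
  have h2 : 1 - x ≠ 0 := by linarith [hx.2]
  have d1 : HasDerivAt (fun x : ℝ => 1 + x) 1 x := (hasDerivAt_id x).const_add 1
  have d2 : HasDerivAt (fun x : ℝ => 1 - x) (-1) x := (hasDerivAt_id x).const_sub 1
  have := (((hasDerivAt_pow p x).const_mul β).add ((hasDerivAt_id x).const_mul h)).sub
    (((d1.mul (d1.log h1)).add (d2.mul (d2.log h2))).const_mul (1 / 2))
  refine this.congr_deriv ?_
  field_simp
  ring

lemma hasDerivAt_Hfun_deriv_one (p : ℕ) (β h : ℝ) {x : ℝ} (hx : x ∈ Set.Ioo (-1 : ℝ) 1) :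
    HasDerivAt
      (fun x : ℝ => β * (p * x ^ (p - 1)) + h - (Real.log (1 + x) - Real.log (1 - x)) / 2)
      (β * (p * ((p - 1 : ℕ) * x ^ (p - 2))) - (1 - x ^ 2)⁻¹) x := by
  have h1 : 1 + x ≠ 0 := by linarith [hx.1]
  have h2 : 1 - x ≠ 0 := by linarith [hx.2]
  have h3 : 1 - x ^ 2 ≠ 0 := by
    rw [show 1 - x ^ 2 = (1 + x) * (1 - x) by ring]; exact mul_ne_zero h1 h2
  have d1 : HasDerivAt (fun x : ℝ => 1 + x) 1 x := (hasDerivAt_id x).const_add 1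
  have d2 : HasDerivAt (fun x : ℝ => 1 - x) (-1) x := (hasDerivAt_id x).const_sub 1
  have := ((((hasDerivAt_pow (p - 1) x).const_mul (p : ℝ)).const_mul β).add_const h).sub
    (((d1.log h1).sub (d2.log h2)).div_const 2)
  refine this.congr_deriv ?_
  rw [Nat.sub_sub]
  congr 1
  field_simp
  ring

lemma hasDerivAt_Hfun_deriv_two (p : ℕ) (β : ℝ) {x : ℝ} (hx : x ∈ Set.Ioo (-1 : ℝ) 1) :
    HasDerivAt
      (fun x : ℝ => β * (p * ((p - 1 : ℕ) * x ^ (p - 2))) - (1 - x ^ 2)⁻¹)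
      (β * (p * ((p - 1 : ℕ) * ((p - 2 : ℕ) * x ^ (p - 3)))) - 2 * x / (1 - x ^ 2) ^ 2) x := by
  have h3 : 1 - x ^ 2 ≠ 0 := by nlinarith [hx.1, hx.2]
  have d1 : HasDerivAt (fun x : ℝ => 1 - x ^ 2) (-(2 * x)) x := by
    simpa using (hasDerivAt_pow 2 x).const_sub 1
  have := ((((hasDerivAt_pow (p - 2) x).const_mul ((p - 1 : ℕ) : ℝ)).const_mul
    (p : ℝ)).const_mul β).sub (d1.inv h3)
  refine this.congr_deriv ?_
  rw [Nat.sub_sub, neg_neg]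

lemma hasDerivAt_Hfun_deriv_three (p : ℕ) (β : ℝ) {x : ℝ} (hx : x ∈ Set.Ioo (-1 : ℝ) 1) :
    HasDerivAt
      (fun x : ℝ => β * (p * ((p - 1 : ℕ) * ((p - 2 : ℕ) * x ^ (p - 3))))
        - 2 * x / (1 - x ^ 2) ^ 2)
      (β * (p * ((p - 1 : ℕ) * ((p - 2 : ℕ) * ((p - 3 : ℕ) * x ^ (p - 4)))))
        - (2 + 6 * x ^ 2) / (1 - x ^ 2) ^ 3) x := by
  have h3 : 1 - x ^ 2 ≠ 0 := by nlinarith [hx.1, hx.2]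
  have d1 : HasDerivAt (fun x : ℝ => 1 - x ^ 2) (-(2 * x)) x := by
    simpa using (hasDerivAt_pow 2 x).const_sub 1
  have d2 : HasDerivAt (fun x : ℝ => 2 * x) 2 x := by
    simpa using (hasDerivAt_id x).const_mul 2
  have := (((((hasDerivAt_pow (p - 3) x).const_mul ((p - 2 : ℕ) : ℝ)).const_mul
    ((p - 1 : ℕ) : ℝ)).const_mul (p : ℝ)).const_mul β).sub
    (d2.div (d1.fun_pow 2) (pow_ne_zero 2 h3))
  refine this.congr_deriv ?_
  rw [Nat.sub_sub]
  congr 1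
  field_simp
  push_cast
  ring

/-- Differentiating an iterated derivative known on `(-1, 1)`. -/
lemma iteratedDeriv_succ_eqOn {f g g' : ℝ → ℝ} {k : ℕ}
    (h : ∀ x ∈ Set.Ioo (-1 : ℝ) 1, iteratedDeriv k f x = g x)
    (hg : ∀ x ∈ Set.Ioo (-1 : ℝ) 1, HasDerivAt g (g' x) x) :
    ∀ x ∈ Set.Ioo (-1 : ℝ) 1, iteratedDeriv (k + 1) f x = g' x := by
  intro x hx
  rw [iteratedDeriv_succ]
  have : iteratedDeriv k f =ᶠ[𝓝 x] g := by
    filter_upwards [isOpen_Ioo.mem_nhds hx] with y hy using h y hy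
  rw [this.deriv_eq, (hg x hx).deriv]

lemma iteratedDeriv_Hfun (p : ℕ) (β h : ℝ) {x : ℝ} (hx : x ∈ Set.Ioo (-1 : ℝ) 1) :
    iteratedDeriv 2 (Hfun p β h) x = β * (p * ((p - 1 : ℕ) * x ^ (p - 2))) - (1 - x ^ 2)⁻¹ ∧
    iteratedDeriv 3 (Hfun p β h) x
      = β * (p * ((p - 1 : ℕ) * ((p - 2 : ℕ) * x ^ (p - 3)))) - 2 * x / (1 - x ^ 2) ^ 2 ∧
    iteratedDeriv 4 (Hfun p β h) x
      = β * (p * ((p - 1 : ℕ) * ((p - 2 : ℕ) * ((p - 3 : ℕ) * x ^ (p - 4)))))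
        - (2 + 6 * x ^ 2) / (1 - x ^ 2) ^ 3 := by
  have i1 := iteratedDeriv_succ_eqOn (f := Hfun p β h) (k := 0)
    (fun x _ => by rw [iteratedDeriv_zero]) (fun x hx => hasDerivAt_Hfun p β h hx)
  have i2 := iteratedDeriv_succ_eqOn i1 (fun x hx => hasDerivAt_Hfun_deriv_one p β h hx)
  have i3 := iteratedDeriv_succ_eqOn i2 (fun x hx => hasDerivAt_Hfun_deriv_two p β hx)
  have i4 := iteratedDeriv_succ_eqOn i3 (fun x hx => hasDerivAt_Hfun_deriv_three p β hx)
  exact ⟨i2 x hx, i3 x hx, i4 x hx⟩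

lemma isMaximizer.isLocalMax {p : ℕ} {β h m : ℝ} (hm : isMaximizer p β h m) :
    IsLocalMax (Hfun p β h) m := by
  filter_upwards [isOpen_Ioo.mem_nhds hm.1] with y hy using hm.2 y ⟨hy.1.le, hy.2.le⟩

lemma pSpecial.iteratedDeriv_three {p : ℕ} {β h m : ℝ} (hsp : pSpecial p β h m) :
    iteratedDeriv 3 (Hfun p β h) m = 0 :=
  iteratedDeriv_three_eq_zero_of_isLocalMax hsp.1.1.isLocalMax (analyticAt_Hfun p β h hsp.1.1.1) hsp.2

lemma pSpecial.iteratedDeriv_four_neg {p : ℕ} (hp : 3 ≤ p) {β h m : ℝ}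
    (hsp : pSpecial p β h m) : iteratedDeriv 4 (Hfun p β h) m < 0 := by
  have hm := hsp.1.1.1
  obtain ⟨e2, e3, e4⟩ := iteratedDeriv_Hfun p β h hm
  have z2 := hsp.2
  have z3 := hsp.iteratedDeriv_three
  rw [e2] at z2
  rw [e3] at z3
  rw [e4]
  have hs : 0 < 1 - m ^ 2 := by nlinarith [hm.1, hm.2]
  set s := 1 - m ^ 2 with hs'
  have hm0 : m ≠ 0 := by
    rintro rfl
    rw [zero_pow (by omega)] at z2
    norm_num [hs'] at z2
  have hm2 : 0 < m ^ 2 := by positivity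
  obtain ⟨q, rfl⟩ : ∃ q, p = q + 3 := ⟨p - 3, by omega⟩
  simp only [Nat.add_sub_cancel, show q + 3 - 1 = q + 2 by omega, show q + 3 - 2 = q + 1 by omega,
    show q + 3 - 4 = q - 1 by omega] at z2 z3 ⊢
  set P : ℝ := β * ((q + 3 : ℕ) * ((q + 2 : ℕ) * m ^ (q + 1))) with hP
  have hPs : P * s = 1 := by
    have : P = s⁻¹ := by linarith
    rw [this]; field_simp
  have h3 : (q + 1 : ℕ) * P * s ^ 2 = 2 * m ^ 2 := by
    have : β * ((q + 3 : ℕ) * ((q + 2 : ℕ) * ((q + 1 : ℕ) * m ^ q))) * s ^ 2 = 2 * m := by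
      have h := sub_eq_zero.1 z3
      rw [h]; field_simp
    calc _ = β * ((q + 3 : ℕ) * ((q + 2 : ℕ) * ((q + 1 : ℕ) * m ^ q))) * s ^ 2 * m := by
          rw [hP]; ring
      _ = _ := by rw [this]; ring
  have h3' : ((q + 1 : ℕ) : ℝ) * s = 2 * m ^ 2 := by
    linear_combination h3 - ((q + 1 : ℕ) : ℝ) * s * hPs
  have h4 : β * ((q + 3 : ℕ) * ((q + 2 : ℕ) * ((q + 1 : ℕ) * (q * m ^ (q - 1))))) * m ^ 2
      = (q + 1 : ℕ) * q * P := by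
    rcases q with _ | q
    · simp
    · rw [hP, Nat.add_sub_cancel]; ring
  rw [sub_neg, lt_div_iff₀ (by positivity)]
  refine lt_of_mul_lt_mul_right ?_ hm2.le
  have h5 : β * ((q + 3 : ℕ) * ((q + 2 : ℕ) * ((q + 1 : ℕ) * (q * m ^ (q - 1))))) * s ^ 3 * m ^ 2
      = (q + 1 : ℕ) * q * s ^ 2 := by
    linear_combination s ^ 3 * h4 + ((q + 1 : ℕ) : ℝ) * q * s ^ 2 * hPs
  rw [h5]
  push_cast at h3' ⊢
  have h6 : ((q : ℝ) + 1) * q * s ^ 2 = 2 * m ^ 2 * (2 * m ^ 2 - s) := by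
    linear_combination (q * s + 2 * m ^ 2) * h3'
  rw [h6]
  nlinarith

lemma Hfun_lt_of_isMaximizer_at_one {p : ℕ} {β h m : ℝ} (hβ : 0 < β) (hh : 0 < h)
    (hm : isMaximizer p β h m) : Hfun p β h 1 < Hfun p β h m := by
  by_contra! hcon
  set c := β * p + h with hc
  have hcpos : 0 < c := by positivity
  set η := Real.exp (-(2 * c)) / 2 with hη
  have hη0 : 0 < η := by positivity
  have hη1 : η < 1 := by
    have : Real.exp (-(2 * c)) ≤ 1 := Real.exp_le_one_iff.2 (by linarith)
    linarith
  have hanti : StrictAntiOn (Hfun p β h) (Set.Icc (1 - η) 1) := by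
    refine strictAntiOn_of_deriv_neg (convex_Icc _ _) (continuous_Hfun p β h).continuousOn ?_
    rw [interior_Icc]
    intro x hx
    have hx0 : 0 < x := by linarith [hx.1]
    rw [(hasDerivAt_Hfun p β h ⟨by linarith, hx.2⟩).deriv]
    have h1 : (p : ℝ) * x ^ (p - 1) ≤ p :=
      mul_le_of_le_one_right (by positivity) (pow_le_one₀ hx0.le hx.2.le)
    have h2 : 0 ≤ Real.log (1 + x) := Real.log_nonneg (by linarith)
    have h3 : Real.log (1 - x) < -(2 * c) := by
      rw [Real.log_lt_iff_lt_exp (by linarith [hx.2])]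
      linarith [hx.1, Real.exp_pos (-(2 * c))]
    have h4 := mul_le_mul_of_nonneg_left h1 hβ.le
    linarith
  have := hanti (Set.left_mem_Icc.2 (by linarith)) (Set.right_mem_Icc.2 (by linarith))
    (by linarith : 1 - η < 1)
  have := hm.2 (1 - η) ⟨by linarith, by linarith⟩
  linarith

lemma isUniqueMaximizer.Hfun_lt {p : ℕ} {β h m : ℝ} (hβ : 0 < β) (hh : 0 < h)
    (hm : isUniqueMaximizer p β h m) {x : ℝ} (hx : x ∈ Set.Icc (-1 : ℝ) 1) (hxm : x ≠ m) :
    Hfun p β h x < Hfun p β h m := by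
  have hone := Hfun_lt_of_isMaximizer_at_one hβ hh hm.1
  rcases eq_or_lt_of_le hx.1 with rfl | hx1
  · refine lt_of_le_of_lt ?_ hone
    have h1 : (-1 : ℝ) ^ p ≤ 1 := by
      rcases neg_one_pow_eq_or ℝ p with h | h <;> rw [h]
      norm_num
    have h2 := mul_le_mul_of_nonneg_left h1 hβ.le
    unfold Hfun binEnt
    norm_num
    linarith
  rcases eq_or_lt_of_le hx.2 with rfl | hx2
  · exact hone
  · refine lt_of_le_of_ne (hm.1.2 x hx) fun heq => hxm (hm.2 x ⟨⟨hx1, hx2⟩, fun y hy => ?_⟩)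
    rw [heq]
    exact hm.1.2 y hy

/-- Away from its unique maximizer, `H` is bounded away from its maximum. -/
lemma isUniqueMaximizer.exists_gap {p : ℕ} {β h m : ℝ} (hβ : 0 < β) (hh : 0 < h)
    (hm : isUniqueMaximizer p β h m) {ε : ℝ} (hε : 0 < ε) :
    ∃ c : ℝ, 0 < c ∧ ∀ x ∈ Set.Icc (-1 : ℝ) 1, ε ≤ |x - m| →
      Hfun p β h x ≤ Hfun p β h m - c := by
  set s := Set.Icc (-1 : ℝ) 1 ∩ {x | ε ≤ |x - m|} with hs
  have hcomp : IsCompact s :=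
    isCompact_Icc.inter_right (isClosed_le continuous_const (by fun_prop))
  rcases s.eq_empty_or_nonempty with hemp | hne
  · refine ⟨1, one_pos, fun x hx hxε => ?_⟩
    have : x ∈ s := ⟨hx, hxε⟩
    rw [hemp] at this
    exact absurd this (Set.notMem_empty x)
  · obtain ⟨z, hz, hmax⟩ := hcomp.exists_isMaxOn hne (continuous_Hfun p β h).continuousOn
    have hzm : z ≠ m := by
      rintro rfl
      have := hz.2
      simp only [sub_self, abs_zero, Set.mem_ofPred_eq] at this
      linarith
    have := hm.Hfun_lt hβ hh hz.1 hzm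
    refine ⟨Hfun p β h m - Hfun p β h z, by linarith, fun x hx hxε => ?_⟩
    have := hmax (show x ∈ s from ⟨hx, hxε⟩)
    simp only [Set.mem_ofPred_eq] at this
    linarith

lemma pSpecial.Hfun_isBigO {p : ℕ} {β h m : ℝ} (hsp : pSpecial p β h m) :
    (fun y => Hfun p β h (m + y)
      - (Hfun p β h m + iteratedDeriv 4 (Hfun p β h) m / 24 * y ^ 4)) =O[𝓝 0]
      fun y => |y| ^ 5 := by
  have h1 : iteratedDeriv 1 (Hfun p β h) m = 0 := by
    rw [iteratedDeriv_one]; exact hsp.1.1.isLocalMax.deriv_eq_zero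
  have := (analyticAt_Hfun p β h hsp.1.1.1).taylor_isBigO 5
  simpa [Finset.sum_range_succ, h1, hsp.2, hsp.iteratedDeriv_three, Nat.factorial] using this

/-- All the local information on `H` near a special point, with uniform constants. -/
lemma pSpecial.exists_local_bounds {p : ℕ} (hp : 3 ≤ p) {β h m : ℝ} (hsp : pSpecial p β h m) :
    ∃ C ε : ℝ, 0 < C ∧ 0 < ε ∧ ∀ y : ℝ, |y| < ε → m + y ∈ Set.Ioo (-1 : ℝ) 1 ∧
      (1 + m) / 2 ≤ 1 + (m + y) ∧ (1 - m) / 2 ≤ 1 - (m + y) ∧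
      |Hfun p β h (m + y) - Hfun p β h m + -iteratedDeriv 4 (Hfun p β h) m / 24 * y ^ 4|
        ≤ C * |y| ^ 5 ∧
      C * |y| ^ 5 ≤ -iteratedDeriv 4 (Hfun p β h) m / 24 / 2 * y ^ 4 ∧
      |Real.log (1 - (m + y) ^ 2) - Real.log (1 - m ^ 2)| ≤ C * |y| := by
  have hm := hsp.1.1.1
  have ha : 0 < -iteratedDeriv 4 (Hfun p β h) m / 24 := by
    have := hsp.iteratedDeriv_four_neg hp
    linarith
  set a := -iteratedDeriv 4 (Hfun p β h) m / 24 with ha'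
  have hs : 0 < 1 - m ^ 2 := by nlinarith [hm.1, hm.2]
  obtain ⟨C₁, hC₁, hO₁⟩ := hsp.Hfun_isBigO.exists_pos
  have hdiff : DifferentiableAt ℝ (fun y => Real.log (1 - (m + y) ^ 2)) 0 := by
    refine DifferentiableAt.log (by fun_prop) ?_
    rw [add_zero]
    exact hs.ne'
  obtain ⟨C₂, hC₂, hO₂⟩ := hdiff.isBigO_sub.exists_pos
  obtain ⟨ε, hε, hb⟩ := Metric.eventually_nhds_iff.1 (hO₁.bound.and hO₂.bound)
  set C := max C₁ C₂ with hC
  have hCpos : 0 < C := lt_max_of_lt_left hC₁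
  have hm1 : 0 < (1 + m) / 2 := by linarith [hm.1]
  have hm2 : 0 < (1 - m) / 2 := by linarith [hm.2]
  refine ⟨C, min (min ε (a / 2 / C)) (min ((1 + m) / 2) ((1 - m) / 2)), hCpos, by positivity,
    fun y hy => ?_⟩
  rw [lt_min_iff, lt_min_iff, lt_min_iff] at hy
  obtain ⟨⟨hy1, hy2⟩, hy3, hy4⟩ := hy
  have hy3' := abs_lt.1 hy3
  have hy4' := abs_lt.1 hy4
  obtain ⟨b1, b2⟩ := hb (y := y) (by rwa [Real.dist_eq, sub_zero])
  rw [Real.norm_eq_abs, Real.norm_eq_abs, abs_of_nonneg (by positivity : 0 ≤ |y| ^ 5)] at b1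
  rw [Real.norm_eq_abs, Real.norm_eq_abs, sub_zero, add_zero] at b2
  refine ⟨⟨by linarith, by linarith⟩, by linarith, by linarith, ?_, ?_, ?_⟩
  · calc _ = |Hfun p β h (m + y)
        - (Hfun p β h m + iteratedDeriv 4 (Hfun p β h) m / 24 * y ^ 4)| := by
          rw [ha']; congr 1; ring
      _ ≤ C₁ * |y| ^ 5 := b1
      _ ≤ _ := by gcongr; exact le_max_left _ _
  · have h4 : |y| ^ 4 = y ^ 4 := by
      rw [show 4 = 2 * 2 by norm_num, pow_mul, sq_abs, ← pow_mul]
    calc C * |y| ^ 5 = C * |y| * y ^ 4 := by rw [← h4]; ring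
      _ ≤ a / 2 * y ^ 4 := by
        gcongr
        rw [lt_div_iff₀ hCpos] at hy2
        linarith
  · exact b2.trans (by gcongr; exact le_max_right _ _)

/-! ### Pointwise approximation of the weights -/

lemma abs_exp_sub_exp_le_s5 {s t M : ℝ} (hs : s ≤ M) (ht : t ≤ M) :
    |Real.exp s - Real.exp t| ≤ |s - t| * Real.exp M := by
  wlog hst : s ≤ t generalizing s t
  · rw [abs_sub_comm, abs_sub_comm s]
    exact this ht hs (le_of_not_ge hst)
  have h1 : Real.exp s ≤ Real.exp t := Real.exp_le_exp.2 hst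
  have h2 : Real.exp s = Real.exp t * Real.exp (s - t) := by rw [← Real.exp_add]; ring_nf
  have h3 := Real.add_one_le_exp (s - t)
  have h4 : Real.exp t ≤ Real.exp M := Real.exp_le_exp.2 ht
  rw [abs_of_nonpos (by linarith), abs_of_nonpos (by linarith)]
  calc -(Real.exp s - Real.exp t) = Real.exp t * (1 - Real.exp (s - t)) := by rw [h2]; ring
    _ ≤ Real.exp t * (t - s) := mul_le_mul_of_nonneg_left (by linarith) (Real.exp_pos _).le
    _ ≤ -(s - t) * Real.exp M := by nlinarith

/-- Logarithm of the normalization under which the level weights approach the quartic density. -/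
def logScale (p N : ℕ) (β h m : ℝ) : ℝ :=
  N * Real.log 2 + N * Hfun p β h m + (Real.log 2 - Real.log π - Real.log N) / 2
    - Real.log (1 - m ^ 2) / 2

lemma levelWeight_pos {p N : ℕ} {β h : ℝ} {j : ℕ} (hj : j ≤ N) : 0 < levelWeight p N β h j := by
  have : 0 < N.choose j := Nat.choose_pos hj
  unfold levelWeight
  positivity

lemma log_levelWeight_sub_logScale {p N j : ℕ} {β h m x : ℝ} (hj : j ≠ 0) (hjN : j < N)
    (hx : x = (2 * j - N) / N) :
    Real.log (levelWeight p N β h j) - logScale p N β h m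
      = N * (Hfun p β h x - Hfun p β h m) - (Real.log (1 - x ^ 2) - Real.log (1 - m ^ 2)) / 2
        + (stirlingErr N - stirlingErr j - stirlingErr (N - j)) := by
  have hc : (0 : ℝ) < N.choose j := Nat.cast_pos.2 (Nat.choose_pos hjN.le)
  rw [levelWeight, ← hx, Real.log_mul hc.ne' (Real.exp_ne_zero _), Real.log_exp,
    log_choose_eq hj hjN hx, logScale]
  unfold Hfun
  ring

lemma levelWeight_le {p N j : ℕ} {β h x : ℝ} (hN : N ≠ 0) (hjN : j ≤ N)
    (hx : x = (2 * j - N) / N) :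
    levelWeight p N β h j ≤ Real.exp (N * Real.log 2 + N * Hfun p β h x) := by
  have h2 : Real.exp (N * Real.log 2) = 2 ^ N := by
    rw [Real.exp_nat_mul, Real.exp_log (by norm_num)]
  rw [levelWeight, ← hx]
  calc _ ≤ 2 ^ N * Real.exp (-(N * binEnt x)) * Real.exp (N * (β * x ^ p + h * x)) := by
        gcongr
        exact choose_le_exp_binEnt_s5 hN hjN hx
    _ = _ := by
        rw [← h2, ← Real.exp_add, ← Real.exp_add]
        unfold Hfun
        congr 1
        ring

lemma abs_stirlingErr_le {N j : ℕ} {m x : ℝ} (hj : j ≠ 0) (hjN : j < N)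
    (hm : m ∈ Set.Ioo (-1 : ℝ) 1) (hx : x = (2 * j - N) / N)
    (h1 : (1 + m) / 2 ≤ 1 + x) (h2 : (1 - m) / 2 ≤ 1 - x) :
    |stirlingErr N - stirlingErr j - stirlingErr (N - j)|
      ≤ (1 + 4 / (1 + m) + 4 / (1 - m)) / N := by
  have hN : (0 : ℝ) < N := Nat.cast_pos.2 (by omega)
  have hj0 : (0 : ℝ) < j := Nat.cast_pos.2 (by omega)
  have hm1 : 0 < 1 + m := by linarith [hm.1]
  have hm2 : 0 < 1 - m := by linarith [hm.2]
  have hk0 : (0 : ℝ) < (N - j : ℕ) := Nat.cast_pos.2 (by omega)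
  have e1 : (j : ℝ) = N * (1 + x) / 2 := by rw [hx]; field_simp; ring
  have e2 : ((N - j : ℕ) : ℝ) = N * (1 - x) / 2 := by
    rw [Nat.cast_sub hjN.le, hx]; field_simp; ring
  have b1 : 1 / (j : ℝ) ≤ 4 / (1 + m) / N := by
    rw [div_div, div_le_div_iff₀ hj0 (by positivity), e1]
    nlinarith
  have b2 : 1 / ((N - j : ℕ) : ℝ) ≤ 4 / (1 - m) / N := by
    rw [div_div, div_le_div_iff₀ hk0 (by positivity), e2]
    nlinarith
  have s1 := stirlingErr_le hj
  have s2 := stirlingErr_le (n := N - j) (by omega)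
  have s3 := stirlingErr_le (n := N) (by omega)
  have t1 := stirlingErr_nonneg hj
  have t2 := stirlingErr_nonneg (n := N - j) (by omega)
  have t3 := stirlingErr_nonneg (n := N) (by omega)
  have p1 : 0 < 4 / (1 + m) / N := by positivity
  have p2 : 0 < 4 / (1 - m) / N := by positivity
  have p3 : 0 < 1 / (N : ℝ) := by positivity
  rw [add_div, add_div, abs_le]
  constructor <;> linarith

lemma pSpecial.exists_near_bound {p : ℕ} (hp : 3 ≤ p) {β h m : ℝ} (hsp : pSpecial p β h m) :
    ∃ K ε : ℝ, 0 < K ∧ 0 < ε ∧ ∀ (N : ℕ) (r : ℝ), 1 ≤ r → r ^ 4 = N → ∀ j ≤ N, ∀ y : ℝ,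
      m + y = (2 * j - N) / N → |y| < ε →
      |levelWeight p N β h j / Real.exp (logScale p N β h m)
        - Real.exp (-(-iteratedDeriv 4 (Hfun p β h) m / 24) * (r * y) ^ 4)|
        ≤ K / r * (1 + (r * y) ^ 2)⁻¹ := by
  have hm := hsp.1.1.1
  have ha : 0 < -iteratedDeriv 4 (Hfun p β h) m / 24 := by
    have := hsp.iteratedDeriv_four_neg hp
    linarith
  obtain ⟨C, ε, hC, hε, hloc⟩ := hsp.exists_local_bounds hp
  set a := -iteratedDeriv 4 (Hfun p β h) m / 24
  obtain ⟨K, hK, hdecay⟩ := exists_mul_exp_neg_quartic_le (half_pos ha)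
  have hm1 : 0 < 1 + m := by linarith [hm.1]
  have hm2 : 0 < 1 - m := by linarith [hm.2]
  set D := 1 + 4 / (1 + m) + 4 / (1 - m) with hD
  have hDpos : 0 < D := by positivity
  refine ⟨(C + D) * Real.exp (C + D) * K, ε, by positivity, hε,
    fun N r hr hrN j hjN y hy hyε => ?_⟩
  have hr0 : 0 < r := by linarith
  have hN : (0 : ℝ) < N := by rw [← hrN]; positivity
  obtain ⟨hmem, l1, l2, hT, hT', hlog⟩ := hloc y hyε
  have hj0 : j ≠ 0 := by
    rintro rfl
    rw [Nat.cast_zero, mul_zero, zero_sub, neg_div, div_self hN.ne'] at hy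
    linarith [hmem.1]
  have hjN' : j < N := by
    refine lt_of_le_of_ne hjN ?_
    rintro rfl
    rw [show (2 * (j : ℝ) - j) / j = 1 by field_simp; ring] at hy
    linarith [hmem.2]
  have hy2 : |y| ≤ 2 := by
    rw [abs_le]
    constructor <;> linarith [hmem.1, hmem.2, hm.1, hm.2]
  have herr := abs_stirlingErr_le hj0 hjN' hm hy l1 l2
  have hlw := log_levelWeight_sub_logScale (p := p) (β := β) (h := h) (m := m) hj0 hjN' hy
  set L := Real.log (levelWeight p N β h j) - logScale p N β h m with hL
  have hv : levelWeight p N β h j / Real.exp (logScale p N β h m) = Real.exp L := by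
    rw [hL, Real.exp_sub, Real.exp_log (levelWeight_pos hjN)]
  have hu4 : (r * y) ^ 4 = N * y ^ 4 := by rw [mul_pow, hrN]
  have habsu : |r * y| = r * |y| := by rw [abs_mul, abs_of_pos hr0]
  have hu5 : N * |y| ^ 5 = |r * y| ^ 5 / r := by rw [habsu, ← hrN]; field_simp
  have hu1 : |y| = |r * y| / r := by rw [habsu]; field_simp
  have hNr : D / N ≤ D / r := by
    rw [← hrN]
    gcongr
    exact le_self_pow₀ hr (by norm_num)
  have hDN : D / N ≤ D := by
    rw [← hrN]
    exact div_le_self hDpos.le (one_le_pow₀ hr)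
  have hdiff : |L - (-a * (r * y) ^ 4)| ≤ N * (C * |y| ^ 5) + C * |y| / 2 + D / N := by
    have e : L - (-a * (r * y) ^ 4)
        = N * (Hfun p β h (m + y) - Hfun p β h m + a * y ^ 4)
          + (-((Real.log (1 - (m + y) ^ 2) - Real.log (1 - m ^ 2)) / 2))
          + (stirlingErr N - stirlingErr j - stirlingErr (N - j)) := by
      rw [hlw, hu4]; ring
    rw [e]
    refine (abs_add_three _ _ _).trans ?_
    rw [abs_mul, abs_neg, abs_div, abs_of_pos hN, abs_two]
    gcongr
  have hsmall : N * (C * |y| ^ 5) ≤ a / 2 * (r * y) ^ 4 := by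
    rw [hu4]
    calc _ ≤ N * (a / 2 * y ^ 4) := by gcongr
      _ = _ := by ring
  have hM1 : L ≤ -(a / 2) * (r * y) ^ 4 + (C + D) := by
    have := (abs_le.1 hdiff).2
    nlinarith
  have hM2 : -a * (r * y) ^ 4 ≤ -(a / 2) * (r * y) ^ 4 + (C + D) := by
    have : 0 ≤ a * (r * y) ^ 4 := by positivity
    linarith
  rw [hv]
  refine (abs_exp_sub_exp_le_s5 hM1 hM2).trans ?_
  have hdiff' : |L - (-a * (r * y) ^ 4)|
      ≤ (C + D) / r * (1 + |r * y| + |r * y| ^ 3 + |r * y| ^ 5) := by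
    refine hdiff.trans ?_
    have e1 : N * (C * |y| ^ 5) = C * (|r * y| ^ 5 / r) := by rw [← hu5]; ring
    rw [e1, hu1]
    have q0 : 0 ≤ |r * y| := abs_nonneg _
    calc C * (|r * y| ^ 5 / r) + C * (|r * y| / r) / 2 + D / N
        ≤ C * (|r * y| ^ 5 / r) + C * (|r * y| / r) + D / r := by
          have : 0 ≤ C * (|r * y| / r) := by positivity
          linarith
      _ ≤ C * (|r * y| ^ 5 / r) + C * (|r * y| / r) + D / r
          + (C / r + C / r * |r * y| ^ 3 + D / r * (|r * y| + |r * y| ^ 3 + |r * y| ^ 5)) := by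
          have : 0 ≤ C / r + C / r * |r * y| ^ 3
            + D / r * (|r * y| + |r * y| ^ 3 + |r * y| ^ 5) := by positivity
          linarith
      _ = _ := by ring
  rw [Real.exp_add]
  calc _ ≤ ((C + D) / r * (1 + |r * y| + |r * y| ^ 3 + |r * y| ^ 5))
        * (Real.exp (-(a / 2) * (r * y) ^ 4) * Real.exp (C + D)) := by gcongr
    _ = (C + D) / r * Real.exp (C + D) * ((1 + |r * y| + |r * y| ^ 3 + |r * y| ^ 5)
        * Real.exp (-(a / 2) * (r * y) ^ 4)) := by ring
    _ ≤ (C + D) / r * Real.exp (C + D) * (K * (1 + (r * y) ^ 2)⁻¹) :=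
        mul_le_mul_of_nonneg_left (hdecay (r * y)) (by positivity)
    _ = _ := by ring

lemma isUniqueMaximizer.exists_far_bound {p : ℕ} {β h m a ε : ℝ} (hβ : 0 < β) (hh : 0 < h)
    (hmax : isUniqueMaximizer p β h m) (ha : 0 < a) (hε : 0 < ε) :
    ∃ K : ℝ, 0 < K ∧ ∀ (N : ℕ) (r : ℝ), 1 ≤ r → r ^ 4 = N → ∀ j ≤ N, ∀ y : ℝ,
      m + y = (2 * j - N) / N → ε ≤ |y| →
      |levelWeight p N β h j / Real.exp (logScale p N β h m) - Real.exp (-a * (r * y) ^ 4)|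
        ≤ K / r * (1 + (r * y) ^ 2)⁻¹ := by
  have hm := hmax.1.1
  obtain ⟨c, hc, hgap⟩ := hmax.exists_gap hβ hh hε
  set b := min c (a * ε ^ 4) with hb
  have hbpos : 0 < b := by positivity
  obtain ⟨K, hK, hdecay⟩ := exists_mul_exp_neg_quartic_le hbpos
  refine ⟨10 * K, by positivity, fun N r hr hrN j hjN y hy hyε => ?_⟩
  have hr0 : 0 < r := by linarith
  have hN : (0 : ℝ) < N := by rw [← hrN]; positivity
  have hN0 : N ≠ 0 := by rintro rfl; simp at hN
  have hjN' : (j : ℝ) ≤ N := Nat.cast_le.2 hjN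
  have hx : m + y ∈ Set.Icc (-1 : ℝ) 1 := by
    rw [hy]
    constructor
    · rw [le_div_iff₀ hN]; linarith [(Nat.cast_nonneg j : (0 : ℝ) ≤ j)]
    · rw [div_le_iff₀ hN]; linarith
  have hgap' := hgap (m + y) hx (by simpa using hyε)
  have hy2 : y ^ 2 ≤ 2 ^ 2 :=
    sq_le_sq' (by linarith [hx.1, hm.2]) (by linarith [hx.2, hm.1])
  have hlogN : Real.exp (Real.log N / 2) = r ^ 2 := by
    rw [← hrN, Real.log_pow, show ((4 : ℕ) : ℝ) * Real.log r / 2 = (2 : ℕ) * Real.log r by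
      push_cast; ring, Real.exp_nat_mul, Real.exp_log hr0]
  have hv : levelWeight p N β h j / Real.exp (logScale p N β h m)
      ≤ 2 * r ^ 2 * Real.exp (-b * r ^ 4) := by
    have h1 := levelWeight_le (p := p) (β := β) (h := h) hN0 hjN hy
    have hπ : Real.log π ≤ 2 * Real.log 2 := by
      rw [show 2 * Real.log 2 = Real.log (2 ^ 2) by rw [Real.log_pow]; norm_num]
      exact Real.log_le_log Real.pi_pos (by linarith [Real.pi_le_four])
    have hs : Real.log (1 - m ^ 2) ≤ 0 :=
      Real.log_nonpos (by nlinarith [hm.1, hm.2]) (by nlinarith)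
    have hl2 : 0 ≤ Real.log 2 := Real.log_nonneg (by norm_num)
    have hbc : b ≤ c := min_le_left _ _
    calc _ ≤ Real.exp (N * Real.log 2 + N * Hfun p β h (m + y))
          / Real.exp (logScale p N β h m) := by gcongr
      _ = Real.exp (N * Real.log 2 + N * Hfun p β h (m + y) - logScale p N β h m) := by
          rw [Real.exp_sub]
      _ ≤ Real.exp (Real.log 2 + Real.log N / 2 + -b * r ^ 4) := by
          rw [Real.exp_le_exp, logScale, hrN]
          nlinarith
      _ = _ := by rw [Real.exp_add, Real.exp_add, Real.exp_log (by norm_num), hlogN]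
  have hf : Real.exp (-a * (r * y) ^ 4) ≤ 2 * r ^ 2 * Real.exp (-b * r ^ 4) := by
    have h1 : ε ^ 4 ≤ y ^ 4 := by
      rw [← Even.pow_abs (by decide : Even 4) y]
      gcongr
    have h2 : b ≤ a * y ^ 4 := (min_le_right _ _).trans (by gcongr)
    calc _ ≤ Real.exp (-b * r ^ 4) := by
          rw [Real.exp_le_exp]
          have := mul_le_mul_of_nonneg_right h2 (by positivity : 0 ≤ r ^ 4)
          rw [mul_pow]
          linarith
      _ ≤ _ := le_mul_of_one_le_left (Real.exp_pos _).le (by nlinarith)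
  have hv0 : 0 < levelWeight p N β h j / Real.exp (logScale p N β h m) :=
    div_pos (levelWeight_pos hjN) (Real.exp_pos _)
  have hf0 := Real.exp_pos (-a * (r * y) ^ 4)
  have hd : r ^ 5 * Real.exp (-b * r ^ 4) ≤ K := by
    have h1 := hdecay r
    rw [abs_of_pos hr0] at h1
    have h2 : K * (1 + r ^ 2)⁻¹ ≤ K :=
      mul_le_of_le_one_right hK.le (inv_le_one_of_one_le₀ (by nlinarith))
    refine le_trans ?_ (h1.trans h2)
    gcongr
    have : 0 < r ^ 3 := by positivity
    linarith
  calc _ ≤ 2 * r ^ 2 * Real.exp (-b * r ^ 4) := by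
        rw [abs_le]; constructor <;> linarith
    _ = 2 * (r ^ 5 * Real.exp (-b * r ^ 4)) / r ^ 3 := by field_simp
    _ ≤ 2 * K / r ^ 3 := by gcongr
    _ = 10 * K / r * (5 * r ^ 2)⁻¹ := by field_simp; norm_num
    _ ≤ 10 * K / r * (1 + (r * y) ^ 2)⁻¹ := by
        gcongr
        rw [mul_pow]
        nlinarith

/-- **Berry–Esseen bound at `p`-special points.** -/
theorem berry_esseen_special
    (p : ℕ) (hp : 3 ≤ p) (β h m : ℝ) (hβ : 0 < β) (hh : 0 < h)
    (hsp : pSpecial p β h m) :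
    ∃ C : ℝ, 0 < C ∧
      ∀ N : ℕ, 1 ≤ N → ∀ x : ℝ, 0 < x →
        |cwProb p N β h
            {σ | (mag σ - N * m) / (N : ℝ) ^ ((3:ℝ)/4) ≤ x} -
          specialCDF (iteratedDeriv 4 (Hfun p β h) m) x|
          ≤ C * (N : ℝ) ^ (-(1:ℝ)/4) := by
  have ha : 0 < -iteratedDeriv 4 (Hfun p β h) m / 24 := by
    have := hsp.iteratedDeriv_four_neg hp
    linarith
  obtain ⟨K₁, ε, hK₁, hε, hnear⟩ := hsp.exists_near_bound hp
  obtain ⟨K₂, hK₂, hfar⟩ := hsp.1.exists_far_bound hβ hh ha hε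
  obtain ⟨C, hC, hkol⟩ := kolmogorov_bound_of_pointwise ha hsp.1.1.1 (lt_max_of_lt_left hK₁ :
    0 < max K₁ K₂)
  refine ⟨C, hC, fun N hN x hx => ?_⟩
  have hN0 : N ≠ 0 := by omega
  have hNpos : (0 : ℝ) < N := Nat.cast_pos.2 hN
  set r : ℝ := (N : ℝ) ^ ((1 : ℝ) / 4) with hr
  have hr1 : 1 ≤ r := Real.one_le_rpow (Nat.one_le_cast.2 hN) (by norm_num)
  have hr0 : 0 < r := by linarith
  have hr4 : r ^ 4 = N := by
    rw [hr, ← Real.rpow_natCast, ← Real.rpow_mul hNpos.le]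
    norm_num
  have hr3 : (N : ℝ) ^ ((3 : ℝ) / 4) = r ^ 3 := by
    rw [hr, ← Real.rpow_natCast, ← Real.rpow_mul hNpos.le]
    norm_num
  have hrinv : C * (N : ℝ) ^ (-(1 : ℝ) / 4) = C / r := by
    rw [neg_div, Real.rpow_neg hNpos.le, ← hr, div_eq_mul_inv]
  rw [hrinv, hr3, specialCDF_eq (hsp.iteratedDeriv_four_neg hp),
    cwProb_eq hN0 β h (fun s => (s - N * m) / r ^ 3 ≤ x)]
  have key := hkol N r (fun j => (2 * j - N - N * m) / r ^ 3)
    (fun j => levelWeight p N β h j / Real.exp (logScale p N β h m)) hr1 hr4 (fun _ => rfl)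
    (fun j hj => div_pos (levelWeight_pos hj) (Real.exp_pos _)) (fun j hj => ?_) x hx
  · rw [← Finset.sum_div, ← Finset.sum_div, div_div_div_cancel_right₀ (Real.exp_ne_zero _)] at key
    exact key
  · have hy : m + ((2 * j - N) / N - m) = (2 * j - N) / (N : ℝ) := by ring
    have hu : (2 * j - N - N * m) / r ^ 3 = r * ((2 * j - N) / N - m) := by
      rw [← hr4]; field_simp
    simp only [hu]
    rcases lt_or_ge |(2 * j - N) / (N : ℝ) - m| ε with hlt | hge
    · refine (hnear N r hr1 hr4 j hj _ hy hlt).trans ?_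
      gcongr
      exact le_max_left _ _
    · refine (hfar N r hr1 hr4 j hj _ hy hge).trans ?_
      gcongr
      exact le_max_right _ _
end
end
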